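/- Let the coefficients satisfy Hypotheses (H) and let G(t,s) be the associated evolution operator. Then there exists a constant C₁ > 0 such that for all p ∈ [2,+∞), s ≥ 0, t > 0, f ∈ C_b(ℝ^d) and x ∈ ℝ^d, |∇_x (G(s+t,s)f)(x)|^p ≤ C₁^p · max(t^{−p/2}, 1) · (G(s+t,s)(|f|^p))(x). -/

import Mathlib

open MeasureTheory Filter Topology Metric Set
open scoped RealInnerProductSpace

noncomputable section

abbrev Ed (d : ℕ) := EuclideanSpace ℝ (Fin d)

/-- `f` belongs to `C_b(ℝ^d)`: it is bounded and continuous. -/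
def IsCb {d : ℕ} (f : Ed d → ℝ) : Prop :=
  Continuous f ∧ ∃ M, ∀ x, |f x| ≤ M

/-- The action of the operator `A(t)φ = Tr(Q(t,·)D²φ) + ⟨b(t,·),∇φ⟩`. -/
def applyA {d : ℕ} (q : ℝ → Ed d → Matrix (Fin d) (Fin d) ℝ) (b : ℝ → Ed d → Ed d)
    (t : ℝ) (u : Ed d → ℝ) (x : Ed d) : ℝ :=
  (∑ i, ∑ j, q t x i j *
      iteratedFDeriv ℝ 2 u x ![EuclideanSpace.single i 1, EuclideanSpace.single j 1]) +
    ⟪b t x, gradient u x⟫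

/-- `u` is a bounded classical solution (in `C_b([s,∞)×ℝ^d) ∩ C^{1,2}((s,∞)×ℝ^d)`)
of `D_t u = A(t)u` on `(s,∞)×ℝ^d` with `u(s,·) = f`. -/
structure IsBoundedClassicalSolution {d : ℕ} (q : ℝ → Ed d → Matrix (Fin d) (Fin d) ℝ)
    (b : ℝ → Ed d → Ed d) (s : ℝ) (f : Ed d → ℝ) (u : ℝ → Ed d → ℝ) : Prop where
  cont : ContinuousOn (fun z : ℝ × Ed d => u z.1 z.2) (Ici s ×ˢ (univ : Set (Ed d)))
  bdd : ∃ M, ∀ t ∈ Ici s, ∀ x, |u t x| ≤ M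
  smooth_space : ∀ t ∈ Ioi s, ContDiff ℝ 2 (u t)
  pde : ∀ t ∈ Ioi s, ∀ x, HasDerivAt (fun τ => u τ x) (applyA q b t (u t) x) t
  init : ∀ x, u s x = f x

/-- Hypotheses (H), together with the associated evolution operator `G(t,s)`. -/
structure Hypotheses (d : ℕ) where
  /-- the Hölder exponent -/
  α : ℝ
  hα : α ∈ Ioo (0:ℝ) 1
  /-- the diffusion coefficients -/
  q : ℝ → Ed d → Matrix (Fin d) (Fin d) ℝ
  /-- the drift coefficients -/
  b : ℝ → Ed d → Ed d
  /-- the ellipticity function -/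
  η : ℝ → Ed d → ℝ
  η₀ : ℝ
  -- (i): local regularity `C^{α/2,1+α}_loc`
  q_diff : ∀ t ∈ Ici (0:ℝ), ∀ i j, Differentiable ℝ fun x => q t x i j
  b_diff : ∀ t ∈ Ici (0:ℝ), Differentiable ℝ (b t)
  q_locHolder : ∀ i j, ∀ T > (0:ℝ), ∀ R > (0:ℝ), ∃ L : ℝ,
    ∀ t ∈ Icc (0:ℝ) T, ∀ s ∈ Icc (0:ℝ) T,
      ∀ x ∈ closedBall (0 : Ed d) R, ∀ y ∈ closedBall (0 : Ed d) R,
        |q t x i j - q s y i j| ≤ L * (|t - s| ^ (α/2) + ‖x - y‖ ^ α) ∧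
        ‖gradient (fun z => q t z i j) x - gradient (fun z => q s z i j) y‖ ≤
          L * (|t - s| ^ (α/2) + ‖x - y‖ ^ α)
  b_locHolder : ∀ i, ∀ T > (0:ℝ), ∀ R > (0:ℝ), ∃ L : ℝ,
    ∀ t ∈ Icc (0:ℝ) T, ∀ s ∈ Icc (0:ℝ) T,
      ∀ x ∈ closedBall (0 : Ed d) R, ∀ y ∈ closedBall (0 : Ed d) R,
        |b t x i - b s y i| ≤ L * (|t - s| ^ (α/2) + ‖x - y‖ ^ α) ∧
        ‖gradient (fun z => b t z i) x - gradient (fun z => b s z i) y‖ ≤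
          L * (|t - s| ^ (α/2) + ‖x - y‖ ^ α)
  -- (i): boundedness on `[0,∞) × B_R` and uniform-in-time `L^p(B_R)` bounds
  q_bdd : ∀ R > (0:ℝ), ∃ M : ℝ, ∀ t ∈ Ici (0:ℝ), ∀ x ∈ ball (0 : Ed d) R, ∀ i j,
    |q t x i j| ≤ M
  q_cont : ∀ R > (0:ℝ), ∀ i j, ContinuousOn (fun z : ℝ × Ed d => q z.1 z.2 i j)
    (Ici (0:ℝ) ×ˢ ball (0 : Ed d) R)
  int_bdd : ∃ p : ℝ, (d : ℝ) + 2 < p ∧ ∀ R > (0:ℝ), ∃ M : ℝ, ∀ t ∈ Ici (0:ℝ), ∀ i j : Fin d,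
    (∫ x in ball (0 : Ed d) R, ‖gradient (fun z => q t z i j) x‖ ^ p) ≤ M ∧
    (∫ x in ball (0 : Ed d) R, |b t x j| ^ p) ≤ M
  -- (ii): symmetry and ellipticity
  q_symm : ∀ t ∈ Ici (0:ℝ), ∀ x, (q t x).IsSymm
  hη₀ : 0 < η₀
  η_lb : ∀ t ∈ Ici (0:ℝ), ∀ x, η₀ ≤ η t x
  ellipticity : ∀ t ∈ Ici (0:ℝ), ∀ x, ∀ ξ : Ed d,
    η t x * ‖ξ‖ ^ 2 ≤ ∑ i, ∑ j, q t x i j * ξ i * ξ j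
  -- (iii): Lyapunov function
  V : Ed d → ℝ
  V_pos : ∀ x, 0 < V x
  V_C2 : ContDiff ℝ 2 V
  V_tendsto : Tendsto V (comap (fun x : Ed d => ‖x‖) atTop) atTop
  a : ℝ
  κ : ℝ
  ha : 0 ≤ a
  hκ : 0 < κ
  lyapunov : ∀ t ∈ Ici (0:ℝ), ∀ x, applyA q b t V x ≤ a - κ * V x
  -- (iv): bounds on the space derivatives of the coefficients
  c₀ : ℝ
  r₀ : ℝ
  hc₀ : 0 ≤ c₀
  gradQ_bdd : ∀ t ∈ Ici (0:ℝ), ∀ x,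
    Real.sqrt (∑ i, ∑ j, ‖gradient (fun z => q t z i j) x‖ ^ 2) ≤ c₀ * η t x
  b_dissip : ∀ t ∈ Ici (0:ℝ), ∀ x, ∀ ξ : Ed d, ⟪fderiv ℝ (b t) x ξ, ξ⟫ ≤ r₀ * ‖ξ‖ ^ 2
  -- (v): growth conditions
  growth : ∃ c > (0:ℝ),
    (∀ t ∈ Ici (0:ℝ), ∀ x,
        Real.sqrt (∑ i, ∑ j, (q t x i j) ^ 2) ≤ c * (1 + ‖x‖) * V x ∧
        ⟪b t x, x⟫ ≤ c * (1 + ‖x‖ ^ 2) * V x) ∨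
    (∀ t ∈ Ici (0:ℝ), ∀ x, Real.sqrt (∑ i, ∑ j, (q t x i j) ^ 2) ≤ c)
  /-- the evolution operator -/
  G : ℝ → ℝ → (Ed d → ℝ) → Ed d → ℝ
  G_sol : ∀ s ∈ Ici (0:ℝ), ∀ f, IsCb f →
    IsBoundedClassicalSolution q b s f fun t => G t s f
  G_unique : ∀ s ∈ Ici (0:ℝ), ∀ f, IsCb f → ∀ u,
    IsBoundedClassicalSolution q b s f u → ∀ t ∈ Ici s, ∀ x, u t x = G t s f x

/-- `{μ_t : t ≥ 0}` is an evolution system of measures for `G(t,s)`. -/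
def IsEvolutionSystem {d : ℕ} (H : Hypotheses d) (μ : ℝ → Measure (Ed d)) : Prop :=
  (∀ t ∈ Ici (0:ℝ), IsProbabilityMeasure (μ t)) ∧
    ∀ f, IsCb f → ∀ s ∈ Ici (0:ℝ), ∀ t ∈ Ici s,
      ∫ x, H.G t s f x ∂μ t = ∫ x, f x ∂μ s

/-- The system `{μ_t : t ≥ 0}` is tight. -/
def IsTightSystem {d : ℕ} (μ : ℝ → Measure (Ed d)) : Prop :=
  ∀ ε > (0:ℝ), ∃ R > (0:ℝ), ∀ t ∈ Ici (0:ℝ),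
    ENNReal.ofReal (1 - ε) ≤ μ t (ball (0 : Ed d) R)

/-- second-order jet at `0` of a function of one real variable. -/
def Jet (φ : ℝ → ℝ) (c1 c2 : ℝ) : Prop :=
  ∃ ψ : ℝ → ℝ, (∀ r, HasDerivAt φ (ψ r) r) ∧ HasDerivAt ψ c2 0 ∧ ψ 0 = c1

lemma Jet.hasDerivAt {φ : ℝ → ℝ} {c1 c2 : ℝ} (h : Jet φ c1 c2) : HasDerivAt φ c1 0 := by
  obtain ⟨ψ, h1, _, h3⟩ := h
  simpa [h3] using h1 0

lemma Jet.add {φ φ' : ℝ → ℝ} {c1 c2 e1 e2 : ℝ} (h : Jet φ c1 c2) (h' : Jet φ' e1 e2) :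
    Jet (fun r => φ r + φ' r) (c1 + e1) (c2 + e2) := by
  obtain ⟨ψ, h1, h2, h3⟩ := h
  obtain ⟨χ, g1, g2, g3⟩ := h'
  exact ⟨fun r => ψ r + χ r, fun r => (h1 r).add (g1 r), h2.add g2, by simp [h3, g3]⟩

lemma Jet.sub {φ φ' : ℝ → ℝ} {c1 c2 e1 e2 : ℝ} (h : Jet φ c1 c2) (h' : Jet φ' e1 e2) :
    Jet (fun r => φ r - φ' r) (c1 - e1) (c2 - e2) := by
  obtain ⟨ψ, h1, h2, h3⟩ := h
  obtain ⟨χ, g1, g2, g3⟩ := h'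
  exact ⟨fun r => ψ r - χ r, fun r => (h1 r).sub (g1 r), h2.sub g2, by simp [h3, g3]⟩

lemma Jet.const_mul {φ : ℝ → ℝ} {c1 c2 : ℝ} (k : ℝ) (h : Jet φ c1 c2) :
    Jet (fun r => k * φ r) (k * c1) (k * c2) := by
  obtain ⟨ψ, h1, h2, h3⟩ := h
  exact ⟨fun r => k * ψ r, fun r => (h1 r).const_mul k, h2.const_mul k, by simp [h3]⟩

lemma Jet.sq {φ : ℝ → ℝ} {c1 c2 : ℝ} (h : Jet φ c1 c2) :
    Jet (fun r => φ r ^ 2) (2 * φ 0 * c1) (2 * φ 0 * c2 + 2 * c1 ^ 2) := by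
  obtain ⟨ψ, h1, h2, h3⟩ := h
  refine ⟨fun r => 2 * φ r * ψ r, fun r => ?_, ?_, by simp [h3]⟩
  · have := (h1 r).mul (h1 r)
    have h5 : (fun r => φ r ^ 2) = φ * φ := by funext r; simp [pow_two]
    rw [h5]
    have h6 : 2 * φ r * ψ r = ψ r * φ r + φ r * ψ r := by ring
    show HasDerivAt (φ * φ) (2 * φ r * ψ r) r
    rw [h6]
    exact this
  · have := ((h1 0).const_mul 2).mul h2
    refine this.congr_deriv ?_
    rw [h3]; ring

lemma Jet.log {φ : ℝ → ℝ} {c1 c2 : ℝ} (h : Jet φ c1 c2) (hp : ∀ r, 0 < φ r) :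
    Jet (fun r => Real.log (φ r)) (c1 / φ 0) (c2 / φ 0 - (c1 / φ 0) ^ 2) := by
  obtain ⟨ψ, h1, h2, h3⟩ := h
  refine ⟨fun r => ψ r / φ r, fun r => (h1 r).log (hp r).ne', ?_, by simp [h3]⟩
  refine (h2.div (h1 0) (hp 0).ne').congr_deriv ?_
  have := (hp 0).ne'
  rw [h3]; field_simp

lemma Jet.first {φ : ℝ → ℝ} {c1 c2 : ℝ} (h : Jet φ c1 c2) (hm : ∀ r, φ r ≤ φ 0) : c1 = 0 := by
  have : IsLocalMax φ 0 := Filter.Eventually.of_forall hm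
  exact this.hasDerivAt_eq_zero h.hasDerivAt

lemma Jet.second {φ : ℝ → ℝ} {c1 c2 : ℝ} (h : Jet φ c1 c2) (hm : ∀ r, φ r ≤ φ 0) : c2 ≤ 0 := by
  by_contra hc
  push Not at hc
  have h0 := h.first hm
  obtain ⟨ψ, h1, h2, h3⟩ := h
  have hd : deriv φ = ψ := funext fun r => (h1 r).deriv
  have hmin : IsLocalMin φ 0 := by
    apply isLocalMin_of_deriv_deriv_pos
    · rw [hd, h2.deriv]; exact hc
    · rw [hd, h3, h0]
    · exact (h1 0).continuousAt
  have hev : ∀ᶠ r in 𝓝 (0:ℝ), φ r = φ 0 := by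
    filter_upwards [hmin] with r hr
    exact le_antisymm (hm r) hr
  have hev2 : ∀ᶠ r in 𝓝 (0:ℝ), ψ r = 0 := by
    filter_upwards [hev.eventually_nhds] with r hr
    have : φ =ᶠ[𝓝 r] fun _ => φ 0 := hr
    rw [← (h1 r).deriv, this.deriv_eq]; simp
  have : deriv ψ 0 = 0 := by
    have h5 : ψ =ᶠ[𝓝 (0:ℝ)] fun _ => 0 := hev2
    rw [h5.deriv_eq]; simp
  rw [h2.deriv] at this
  linarith

lemma jet_line {d : ℕ} {h : Ed d → ℝ} (hh : ContDiff ℝ 2 h) (x a : Ed d) :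
    Jet (fun r => h (x + r • a)) (fderiv ℝ h x a) (fderiv ℝ (fderiv ℝ h) x a a) := by
  have hl : ∀ r : ℝ, HasDerivAt (fun r : ℝ => x + r • a) a r := fun r => by
    simpa using ((hasDerivAt_id r).smul_const a).const_add x
  have hd : Differentiable ℝ h := hh.differentiable (by norm_num)
  have hd2 : Differentiable ℝ (fderiv ℝ h) :=
    (hh.fderiv_right (m := 1) (by norm_num)).differentiable (by norm_num)
  refine ⟨fun r => fderiv ℝ h (x + r • a) a, fun r => ?_, ?_, by simp⟩
  · exact (hd (x + r • a)).hasFDerivAt.comp_hasDerivAt r (hl r)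
  · have h1 : HasFDerivAt (fderiv ℝ h) (fderiv ℝ (fderiv ℝ h) x) (x + (0:ℝ) • a) := by
      simpa using (hd2 x).hasFDerivAt
    have h2 := h1.comp_hasDerivAt (0:ℝ) (hl 0)
    have := h2.clm_apply (hasDerivAt_const (0:ℝ) a)
    simpa using this

/-- columns of a matrix -/
def colv {d : ℕ} (A : Matrix (Fin d) (Fin d) ℝ) (m : Fin d) : Ed d := WithLp.toLp 2 (fun i => A i m)

lemma bilin_col {d : ℕ} (A : Matrix (Fin d) (Fin d) ℝ) (B : Ed d →L[ℝ] Ed d →L[ℝ] ℝ) :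
    ∑ m, B (colv A m) (colv A m) =
      ∑ i, ∑ j, (A * A.transpose) i j *
        B (EuclideanSpace.single i 1) (EuclideanSpace.single j 1) := by
  have hc : ∀ m, colv A m = ∑ i, A i m • EuclideanSpace.single i (1:ℝ) := by
    intro m
    ext k
    simp [colv, Finset.sum_apply, Pi.single_apply]
  simp_rw [hc]
  simp only [map_sum, map_smul, sum_apply, smul_apply,
    smul_eq_mul, Matrix.mul_apply, Matrix.transpose_apply, Finset.sum_mul, Finset.mul_sum]
  rw [Finset.sum_comm]
  conv_rhs => rw [Finset.sum_comm]
  refine Finset.sum_congr rfl fun i _ => ?_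
  rw [Finset.sum_comm]
  refine Finset.sum_congr rfl fun j _ => Finset.sum_congr rfl fun m _ => ?_
  ring

lemma applyA_eq {d : ℕ} (q : ℝ → Ed d → Matrix (Fin d) (Fin d) ℝ) (b : ℝ → Ed d → Ed d)
    (t : ℝ) (u : Ed d → ℝ) (x : Ed d)
    (A : Matrix (Fin d) (Fin d) ℝ) (hA : A * A.transpose = q t x) :
    applyA q b t u x = ∑ m, fderiv ℝ (fderiv ℝ u) x (colv A m) (colv A m) + fderiv ℝ u x (b t x) := by
  rw [applyA, bilin_col, hA]
  congr 1
  · simp [iteratedFDeriv_two_apply]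
  · rw [real_inner_comm, inner_gradient_left]

lemma quad_col {d : ℕ} (A : Matrix (Fin d) (Fin d) ℝ) (v : Ed d) :
    ∑ m, (inner ℝ v (colv A m)) ^ 2 = ∑ i, ∑ j, (A * A.transpose) i j * v i * v j := by
  have := bilin_col A ((innerSL ℝ v).smulRight (innerSL ℝ v))
  simp only [ContinuousLinearMap.smulRight_apply, smul_apply, innerSL_apply_apply,
    smul_eq_mul] at this
  simp only [pow_two, this]
  simp [EuclideanSpace.inner_single_right, mul_assoc]
open Matrix in
lemma exists_msqrt {d : ℕ} (P : Matrix (Fin d) (Fin d) ℝ) (hs : P.IsSymm) (l : ℝ) (hl : 0 < l)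
    (h : ∀ ξ : Ed d, l * ‖ξ‖ ^ 2 ≤ ∑ i, ∑ j, P i j * ξ i * ξ j) :
    ∃ A : Matrix (Fin d) (Fin d) ℝ, A.transpose = A ∧ A * A = P ∧
      ∀ ξ : Fin d → ℝ, √l * (ξ ⬝ᵥ ξ) ≤ ξ ⬝ᵥ (A *ᵥ ξ) := by
  have hP : P.IsHermitian := by
    rw [Matrix.IsHermitian, Matrix.conjTranspose_eq_transpose_of_trivial]; exact hs
  set U : Matrix (Fin d) (Fin d) ℝ := (hP.eigenvectorUnitary : Matrix (Fin d) (Fin d) ℝ) with hU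
  set e := hP.eigenvalues with he
  have hUU : U.transpose * U = 1 := by
    have := Unitary.coe_star_mul_self hP.eigenvectorUnitary
    rwa [Matrix.star_eq_conjTranspose, Matrix.conjTranspose_eq_transpose_of_trivial] at this
  have hUU' : U * U.transpose = 1 := by
    exact mul_eq_one_comm.mp hUU
  have hspec : P = U * Matrix.diagonal e * U.transpose := by
    have := hP.spectral_theorem
    rw [Unitary.conjStarAlgAut_apply, Matrix.star_eq_conjTranspose,
      Matrix.conjTranspose_eq_transpose_of_trivial] at this
    exact this
  have hel : ∀ i, l ≤ e i := by
    intro i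
    have h1 := h (hP.eigenvectorBasis i)
    have h2 := hP.mulVec_eigenvectorBasis i
    have h3 : ‖hP.eigenvectorBasis i‖ = 1 := hP.eigenvectorBasis.orthonormal.1 i
    have h4 : ∑ k, ∑ j, P k j * hP.eigenvectorBasis i k * hP.eigenvectorBasis i j = e i := by
      have : ∀ k, ∑ j, P k j * hP.eigenvectorBasis i k * hP.eigenvectorBasis i j
          = e i * (hP.eigenvectorBasis i k) ^ 2 := by
        intro k
        have h5 := congrFun h2 k
        simp only [Matrix.mulVec, dotProduct, Pi.smul_apply, smul_eq_mul] at h5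
        calc _ = hP.eigenvectorBasis i k * ∑ j, P k j * hP.eigenvectorBasis i j := by
              rw [Finset.mul_sum]; exact Finset.sum_congr rfl fun j _ => by ring
          _ = _ := by rw [h5]; ring
      simp_rw [this]
      rw [← Finset.mul_sum, ← EuclideanSpace.real_norm_sq_eq, h3]; simp
    rw [h4, h3] at h1
    simpa using h1
  refine ⟨U * Matrix.diagonal (fun i => √(e i)) * U.transpose, ?_, ?_, ?_⟩
  · simp [Matrix.transpose_mul, Matrix.mul_assoc]
  · rw [hspec]
    have : Matrix.diagonal (fun i => √(e i)) * Matrix.diagonal (fun i => √(e i))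
        = Matrix.diagonal e := by
      rw [Matrix.diagonal_mul_diagonal]
      congr 1
      funext i
      exact Real.mul_self_sqrt (hl.le.trans (hel i))
    calc _ = U * Matrix.diagonal (fun i => √(e i)) * (U.transpose * U)
            * Matrix.diagonal (fun i => √(e i)) * U.transpose := by simp only [Matrix.mul_assoc]
      _ = U * (Matrix.diagonal (fun i => √(e i)) * Matrix.diagonal (fun i => √(e i)))
            * U.transpose := by rw [hUU]; simp only [Matrix.mul_assoc, Matrix.mul_one]
      _ = _ := by rw [this]
  · intro ξ
    set z := U.transpose *ᵥ ξ with hz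
    have h1 : ξ ⬝ᵥ ((U * Matrix.diagonal (fun i => √(e i)) * U.transpose) *ᵥ ξ)
        = ∑ i, √(e i) * z i ^ 2 := by
      rw [← Matrix.mulVec_mulVec, ← Matrix.mulVec_mulVec, Matrix.dotProduct_mulVec,
        ← Matrix.mulVec_transpose, ← hz]
      simp only [dotProduct, Matrix.mulVec_diagonal]
      exact Finset.sum_congr rfl fun i _ => by ring
    have h2 : ξ ⬝ᵥ ξ = ∑ i, z i ^ 2 := by
      have : z ⬝ᵥ z = ξ ⬝ᵥ ξ := by
        conv_lhs => rw [hz, Matrix.dotProduct_mulVec, ← Matrix.mulVec_transpose,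
          Matrix.transpose_transpose, Matrix.mulVec_mulVec, hUU', Matrix.one_mulVec]
      rw [← this]
      simp [dotProduct, sq]
    rw [h1, h2, Finset.mul_sum]
    exact Finset.sum_le_sum fun i _ =>
      mul_le_mul_of_nonneg_right (Real.sqrt_le_sqrt (hel i)) (sq_nonneg _)

open Matrix in
lemma sqrt_diff {d : ℕ} (P Q A B : Matrix (Fin d) (Fin d) ℝ) (l : ℝ) (hl : 0 < l)
    (hA : A.transpose = A) (hB : B.transpose = B) (hAP : A * A = P) (hBQ : B * B = Q)
    (hAl : ∀ ξ : Fin d → ℝ, √l * (ξ ⬝ᵥ ξ) ≤ ξ ⬝ᵥ (A *ᵥ ξ))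
    (hB0 : ∀ ξ : Fin d → ℝ, 0 ≤ ξ ⬝ᵥ (B *ᵥ ξ)) :
    l * ∑ m, ‖colv A m - colv B m‖ ^ 2 ≤ ∑ i, ∑ j, (P i j - Q i j) ^ 2 := by
  set D := A - B with hD
  have hDt : D.transpose = D := by rw [hD, Matrix.transpose_sub, hA, hB]
  have hDs : ∀ i j, D i j = D j i := fun i j => by
    conv_lhs => rw [← hDt, Matrix.transpose_apply]
  have hS : ∑ m, ‖colv A m - colv B m‖ ^ 2 = ∑ m, ((fun i => D i m) ⬝ᵥ (fun i => D i m)) := by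
    refine Finset.sum_congr rfl fun m _ => ?_
    rw [EuclideanSpace.real_norm_sq_eq]
    simp [colv, dotProduct, hD, sq]
  set S := ∑ m, ‖colv A m - colv B m‖ ^ 2 with hSd
  set R := ∑ i, ∑ j, (P i j - Q i j) ^ 2 with hR
  have hSD : S = ∑ i, ∑ j, D i j ^ 2 := by
    rw [hS, Finset.sum_comm]
    simp only [dotProduct, sq]
  have htr : ∀ C : Matrix (Fin d) (Fin d) ℝ,
      (D * C * D).trace = ∑ m, ((fun i => D i m) ⬝ᵥ (C *ᵥ (fun i => D i m))) := by
    intro C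
    rw [Matrix.mul_assoc]
    simp only [Matrix.trace, Matrix.diag, Matrix.mul_apply, dotProduct, Matrix.mulVec]
    exact Finset.sum_congr rfl fun m _ => Finset.sum_congr rfl fun i _ => by rw [hDs]
  have hid : D * (P - Q) = D * A * D + D * (D * B) := by
    rw [← hAP, ← hBQ, hD]; noncomm_ring
  have hT : (D * (P - Q)).trace = (D * A * D).trace + (D * B * D).trace := by
    rw [hid, Matrix.trace_add, Matrix.trace_mul_comm D (D * B)]
  have h1 : √l * S ≤ (D * (P - Q)).trace := by
    rw [hT, htr, htr, hS, Finset.mul_sum]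
    have := Finset.sum_nonneg fun m (_ : m ∈ Finset.univ) => hB0 (fun i => D i m)
    have h2 := Finset.sum_le_sum fun m (_ : m ∈ Finset.univ) => hAl (fun i => D i m)
    linarith
  have h3 : ((D * (P - Q)).trace) ^ 2 ≤ S * R := by
    have : (D * (P - Q)).trace = ∑ p : Fin d × Fin d, D p.1 p.2 * (P p.1 p.2 - Q p.1 p.2) := by
      rw [Fintype.sum_prod_type]
      rw [Matrix.trace_mul_comm]
      simp only [Matrix.trace, Matrix.diag, Matrix.mul_apply, Matrix.sub_apply]
      exact Finset.sum_congr rfl fun m _ => Finset.sum_congr rfl fun i _ => by rw [hDs]; ring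
    rw [this, hSD, hR, ← Fintype.sum_prod_type' (f := fun i j => D i j ^ 2),
      ← Fintype.sum_prod_type' (f := fun i j => (P i j - Q i j) ^ 2)]
    exact Finset.sum_mul_sq_le_sq_mul_sq _ _ _
  have hS0 : 0 ≤ S := Finset.sum_nonneg fun _ _ => sq_nonneg _
  have hR0 : 0 ≤ R := Finset.sum_nonneg fun _ _ => Finset.sum_nonneg fun _ _ => sq_nonneg _
  rcases hS0.eq_or_lt with h0 | h0
  · rw [← h0]; simpa using hR0
  · have h4 : (√l * S) ^ 2 ≤ S * R :=
      (pow_le_pow_left₀ (mul_nonneg (Real.sqrt_nonneg _) hS0) h1 2).trans h3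
    rw [mul_pow, Real.sq_sqrt hl.le] at h4
    nlinarith
/-- the quadratic form of the diffusion matrix -/
def qform {d : ℕ} (H : Hypotheses d) (t : ℝ) (x ξ : Ed d) : ℝ := ∑ i, ∑ j, H.q t x i j * ξ i * ξ j

lemma norm_gradient_eq {d : ℕ} (h : Ed d → ℝ) (x : Ed d) : ‖gradient h x‖ = ‖fderiv ℝ h x‖ := by
  simp [gradient]

lemma gradQ_sq {d : ℕ} (H : Hypotheses d) {t : ℝ} (ht : t ∈ Ici (0:ℝ)) (x : Ed d) :
    ∑ i, ∑ j, ‖gradient (fun z => H.q t z i j) x‖ ^ 2 ≤ (H.c₀ * H.η t x) ^ 2 := by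
  have h := H.gradQ_bdd t ht x
  exact (Real.sqrt_le_left (mul_nonneg H.hc₀ (H.hη₀.le.trans (H.η_lb t ht x)))).mp h

lemma grad_entry {d : ℕ} (H : Hypotheses d) {t : ℝ} (ht : t ∈ Ici (0:ℝ)) (x : Ed d) (i j : Fin d) :
    ‖gradient (fun z => H.q t z i j) x‖ ≤ H.c₀ * H.η t x := by
  have h0 : 0 ≤ H.c₀ * H.η t x := mul_nonneg H.hc₀ (H.hη₀.le.trans (H.η_lb t ht x))
  refine le_of_sq_le_sq ?_ h0
  refine le_trans ?_ (gradQ_sq H ht x)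
  refine le_trans ?_ (Finset.single_le_sum
    (f := fun i => ∑ j, ‖gradient (fun z => H.q t z i j) x‖ ^ 2)
    (fun i _ => Finset.sum_nonneg fun _ _ => sq_nonneg _) (Finset.mem_univ i))
  exact Finset.single_le_sum (f := fun j => ‖gradient (fun z => H.q t z i j) x‖ ^ 2)
    (fun i _ => sq_nonneg _) (Finset.mem_univ j)

lemma cs_double {d : ℕ} (a : Fin d → Fin d → ℝ) (ξ : Ed d) (c : ℝ) (hc : 0 ≤ c)
    (ha : ∑ i, ∑ j, a i j ^ 2 ≤ c ^ 2) :
    ∑ i, ∑ j, a i j * ξ i * ξ j ≤ c * ‖ξ‖ ^ 2 := by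
  refine le_of_sq_le_sq ?_ (by positivity)
  have h1 : ∑ i, ∑ j, a i j * ξ i * ξ j =
      ∑ p : Fin d × Fin d, a p.1 p.2 * (ξ p.1 * ξ p.2) := by
    rw [Fintype.sum_prod_type]; simp only [mul_assoc]
  have h2 : ∑ p : Fin d × Fin d, (ξ p.1 * ξ p.2) ^ 2 = (‖ξ‖ ^ 2) ^ 2 := by
    rw [Fintype.sum_prod_type, EuclideanSpace.real_norm_sq_eq, sq (∑ i, ξ i ^ 2),
      Finset.sum_mul_sum]
    simp only [mul_pow]
  have h3 : ∑ p : Fin d × Fin d, a p.1 p.2 ^ 2 ≤ c ^ 2 := by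
    rw [Fintype.sum_prod_type]; exact ha
  rw [h1, mul_pow]
  refine (Finset.sum_mul_sq_le_sq_mul_sq _ _ _).trans ?_
  rw [h2]
  exact mul_le_mul_of_nonneg_right h3 (sq_nonneg _)

lemma qform_exp {d : ℕ} (H : Hypotheses d) {t : ℝ} (ht : t ∈ Ici (0:ℝ)) (x z ξ : Ed d) :
    qform H t z ξ ≤ Real.exp (H.c₀ * ‖z - x‖) * qform H t x ξ := by
  set φ : ℝ → ℝ := fun r => qform H t (x + r • (z - x)) ξ with hφ
  set φ' : ℝ → ℝ := fun r => ∑ i, ∑ j,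
    fderiv ℝ (fun y => H.q t y i j) (x + r • (z - x)) (z - x) * ξ i * ξ j with hφ'
  set K := H.c₀ * ‖z - x‖ with hK
  have hl : ∀ r : ℝ, HasDerivAt (fun r : ℝ => x + r • (z - x)) (z - x) r := fun r => by
    simpa using ((hasDerivAt_id r).smul_const (z - x)).const_add x
  have hd : ∀ r, HasDerivAt φ (φ' r) r := by
    intro r
    refine HasDerivAt.fun_sum fun i _ => HasDerivAt.fun_sum fun j _ => ?_
    refine HasDerivAt.mul_const (HasDerivAt.mul_const ?_ _) _
    exact (H.q_diff t ht i j (x + r • (z - x))).hasFDerivAt.comp_hasDerivAt r (hl r)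
  have hb : ∀ r, φ' r ≤ K * φ r := by
    intro r
    set y := x + r • (z - x)
    have hη : 0 ≤ H.η t y := H.hη₀.le.trans (H.η_lb t ht y)
    have h1 : φ' r ≤ (H.c₀ * H.η t y * ‖z - x‖) * ‖ξ‖ ^ 2 := by
      refine cs_double _ ξ _ (by have := H.hc₀; positivity) ?_
      rw [mul_pow]
      refine le_trans ?_ (mul_le_mul_of_nonneg_right (gradQ_sq H ht y) (sq_nonneg _))
      rw [Finset.sum_mul]
      refine Finset.sum_le_sum fun i _ => ?_
      rw [Finset.sum_mul]
      refine Finset.sum_le_sum fun j _ => ?_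
      rw [← mul_pow, norm_gradient_eq, ← sq_abs]
      refine pow_le_pow_left₀ (abs_nonneg _) ?_ 2
      exact (fderiv ℝ (fun y => H.q t y i j) y).le_opNorm (z - x)
    have h2 : H.η t y * ‖ξ‖ ^ 2 ≤ φ r := H.ellipticity t ht y ξ
    have h3 : K * (H.η t y * ‖ξ‖ ^ 2) ≤ K * φ r :=
      mul_le_mul_of_nonneg_left h2 (mul_nonneg H.hc₀ (norm_nonneg _))
    refine h1.trans (le_trans (le_of_eq ?_) h3)
    rw [hK]; ring
  have hψ : ∀ r, HasDerivAt (fun r => Real.exp (-K * r) * φ r)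
      (Real.exp (-K * r) * (φ' r - K * φ r)) r := by
    intro r
    have h1 : HasDerivAt (fun r => Real.exp (-K * r)) (Real.exp (-K * r) * (-K)) r := by
      have := ((hasDerivAt_id r).const_mul (-K)).exp
      simpa using this
    exact (h1.mul (hd r)).congr_deriv (by ring)
  have hanti : Antitone (fun r => Real.exp (-K * r) * φ r) := by
    refine antitone_of_deriv_nonpos (fun r => (hψ r).differentiableAt) fun r => ?_
    rw [(hψ r).deriv]
    exact mul_nonpos_of_nonneg_of_nonpos (Real.exp_pos _).le (by linarith [hb r])
  have h01 := hanti (zero_le_one (α := ℝ))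
  simp only [mul_one, mul_zero, Real.exp_zero, one_mul] at h01
  have e1 : φ 1 = qform H t z ξ := by simp [hφ]
  have e0 : φ 0 = qform H t x ξ := by simp [hφ]
  rw [e1, e0, Real.exp_neg] at h01
  have hE := Real.exp_pos K
  rw [inv_mul_le_iff₀ hE] at h01
  exact h01

lemma exists_lam {d : ℕ} [NeZero d] (H : Hypotheses d) {t : ℝ} (ht : t ∈ Ici (0:ℝ)) (x : Ed d) :
    ∃ l, H.η₀ ≤ l ∧ (∀ ξ, l * ‖ξ‖ ^ 2 ≤ qform H t x ξ) ∧ ∃ ξ₀ : Ed d, ‖ξ₀‖ = 1 ∧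
      qform H t x ξ₀ = l := by
  have hne : (sphere (0 : Ed d) 1).Nonempty := by
    refine ⟨EuclideanSpace.single 0 1, by simp⟩
  have hcont : Continuous (qform H t x) := by
    unfold qform; fun_prop
  obtain ⟨ξ₀, hξ, hmin⟩ := (isCompact_sphere (0 : Ed d) 1).exists_isMinOn hne hcont.continuousOn
  have hn : ‖ξ₀‖ = 1 := by simpa using hξ
  refine ⟨qform H t x ξ₀, ?_, ?_, ξ₀, hn, rfl⟩
  · have := H.ellipticity t ht x ξ₀
    rw [hn] at this
    have h2 := H.η_lb t ht x
    simp only [one_pow, mul_one] at this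
    exact h2.trans this
  · intro ξ
    rcases eq_or_ne ξ 0 with rfl | h0
    · simp [qform]
    · have hp : 0 < ‖ξ‖ := norm_pos_iff.mpr h0
      have h1 : (‖ξ‖⁻¹ • ξ) ∈ sphere (0 : Ed d) 1 := by
        simp [norm_smul, hp.ne']
      have h2 : qform H t x ξ₀ ≤ qform H t x (‖ξ‖⁻¹ • ξ) := hmin h1
      have h3 : qform H t x (‖ξ‖⁻¹ • ξ) * ‖ξ‖ ^ 2 = qform H t x ξ := by
        simp only [qform, Finset.sum_mul, PiLp.smul_apply, smul_eq_mul]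
        refine Finset.sum_congr rfl fun i _ => Finset.sum_congr rfl fun j _ => ?_
        field_simp
      rw [← h3]
      exact mul_le_mul_of_nonneg_right h2 (sq_nonneg _)

lemma q_entry_diff {d : ℕ} (H : Hypotheses d) {t : ℝ} (ht : t ∈ Ici (0:ℝ)) (x y ξ₀ : Ed d) (l : ℝ)
    (hn : ‖ξ₀‖ = 1) (hl : qform H t x ξ₀ = l) (hxy : ‖x - y‖ ≤ 1) (i j : Fin d) :
    |H.q t x i j - H.q t y i j| ≤ H.c₀ * Real.exp H.c₀ * l * ‖x - y‖ := by
  have hx : x ∈ closedBall x 1 := by simp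
  have hy : y ∈ closedBall x 1 := by simpa [dist_eq_norm, norm_sub_rev] using hxy
  refine (convex_closedBall x 1).norm_image_sub_le_of_norm_fderiv_le (𝕜 := ℝ)
    (f := fun z => H.q t z i j) (fun z _ => H.q_diff t ht i j z) (fun z hz => ?_) hy hx
  rw [← norm_gradient_eq]
  refine (grad_entry H ht z i j).trans ?_
  rw [mul_assoc]
  refine mul_le_mul_of_nonneg_left ?_ H.hc₀
  have h1 := H.ellipticity t ht z ξ₀
  rw [hn] at h1
  have h2 := qform_exp H ht x z ξ₀
  have hz' : ‖z - x‖ ≤ 1 := by simpa [dist_eq_norm] using hz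
  have hl0 : 0 ≤ l := by
    rw [← hl]
    have := H.ellipticity t ht x ξ₀
    exact le_trans (mul_nonneg (H.hη₀.le.trans (H.η_lb t ht x)) (sq_nonneg _)) this
  have h3 : Real.exp (H.c₀ * ‖z - x‖) ≤ Real.exp H.c₀ := by
    apply Real.exp_le_exp.mpr
    nlinarith [H.hc₀]
  rw [hl] at h2
  calc H.η t z ≤ qform H t z ξ₀ := by simpa [qform] using h1
    _ ≤ _ := h2
    _ ≤ _ := mul_le_mul_of_nonneg_right h3 hl0

lemma b_diss {d : ℕ} (H : Hypotheses d) {t : ℝ} (ht : t ∈ Ici (0:ℝ)) (x y : Ed d) :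
    inner ℝ (H.b t x - H.b t y) (x - y) ≤ H.r₀ * ‖x - y‖ ^ 2 := by
  have hl : ∀ r : ℝ, HasDerivAt (fun r : ℝ => y + r • (x - y)) (x - y) r := fun r => by
    simpa using ((hasDerivAt_id r).smul_const (x - y)).const_add y
  have hd : ∀ r : ℝ, HasDerivAt (fun r : ℝ => inner ℝ (H.b t (y + r • (x - y))) (x - y))
      (inner ℝ (fderiv ℝ (H.b t) (y + r • (x - y)) (x - y)) (x - y)) r := by
    intro r
    have h1 := (H.b_diff t ht (y + r • (x - y))).hasFDerivAt.comp_hasDerivAt r (hl r)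
    have := h1.inner ℝ (hasDerivAt_const r (x - y))
    simpa using this
  have h := image_sub_le_mul_sub_of_deriv_le (fun r => (hd r).differentiableAt)
    (C := H.r₀ * ‖x - y‖ ^ 2) (fun r => by rw [(hd r).deriv]; exact H.b_dissip t ht _ _)
    (zero_le_one (α := ℝ))
  simpa [inner_sub_left] using h

/-- Synchronous coupling vectors at a pair of points. -/
lemma exists_coupling_aux {d : ℕ} [NeZero d] (H : Hypotheses d) {t : ℝ} (ht : t ∈ Ici (0:ℝ))
    (x y : Ed d) (hxy : ‖x - y‖ ≤ 1) :
    ∃ (l : ℝ) (A B : Matrix (Fin d) (Fin d) ℝ), H.η₀ ≤ l ∧ A * A.transpose = H.q t x ∧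
      B * B.transpose = H.q t y ∧ (∀ v, l * ‖v‖ ^ 2 ≤ ∑ m, (inner ℝ v (colv A m)) ^ 2) ∧
      ∑ m, ‖colv A m - colv B m‖ ^ 2 ≤
        ((d : ℝ) * H.c₀ * Real.exp H.c₀) ^ 2 * l * ‖x - y‖ ^ 2 := by
  obtain ⟨l, hl, hlow, ξ₀, hn, hξ⟩ := exists_lam H ht x
  have hl0 : 0 < l := H.hη₀.trans_le hl
  obtain ⟨A, hA, hAA, hAl⟩ := exists_msqrt (H.q t x) (H.q_symm t ht x) l hl0 hlow
  obtain ⟨B, hB, hBB, hBl⟩ := exists_msqrt (H.q t y) (H.q_symm t ht y) H.η₀ H.hη₀ (fun ξ =>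
    (mul_le_mul_of_nonneg_right (H.η_lb t ht y) (sq_nonneg _)).trans (H.ellipticity t ht y ξ))
  refine ⟨l, A, B, hl, by rw [hA, hAA], by rw [hB, hBB], ?_, ?_⟩
  · intro v
    rw [quad_col, hA, hAA]
    exact hlow v
  · have h1 := sqrt_diff _ _ A B l hl0 hA hB hAA hBB hAl (fun ξ => le_trans
      (mul_nonneg (Real.sqrt_nonneg _) (by
        simp only [dotProduct]; exact Finset.sum_nonneg fun _ _ => mul_self_nonneg _)) (hBl ξ))
    have h2 : ∑ i, ∑ j, (H.q t x i j - H.q t y i j) ^ 2 ≤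
        (d : ℝ) ^ 2 * (H.c₀ * Real.exp H.c₀ * l * ‖x - y‖) ^ 2 := by
      calc _ ≤ ∑ i : Fin d, ∑ j : Fin d, (H.c₀ * Real.exp H.c₀ * l * ‖x - y‖) ^ 2 := by
            refine Finset.sum_le_sum fun i _ => Finset.sum_le_sum fun j _ => ?_
            rw [← sq_abs]
            exact pow_le_pow_left₀ (abs_nonneg _) (q_entry_diff H ht x y ξ₀ l hn hξ hxy i j) 2
        _ = _ := by simp; ring
    have h3 := h1.trans h2
    refine le_of_mul_le_mul_left (h3.trans (le_of_eq ?_)) hl0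
    ring

lemma exists_coupling {d : ℕ} (H : Hypotheses d) {t : ℝ} (ht : t ∈ Ici (0:ℝ))
    (x y : Ed d) (hxy : ‖x - y‖ ≤ 1) :
    ∃ (l : ℝ) (A B : Matrix (Fin d) (Fin d) ℝ), H.η₀ ≤ l ∧ A * A.transpose = H.q t x ∧
      B * B.transpose = H.q t y ∧ (∀ v, l * ‖v‖ ^ 2 ≤ ∑ m, (inner ℝ v (colv A m)) ^ 2) ∧
      ∑ m, ‖colv A m - colv B m‖ ^ 2 ≤
        ((d : ℝ) * H.c₀ * Real.exp H.c₀) ^ 2 * l * ‖x - y‖ ^ 2 := by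
  rcases Nat.eq_zero_or_pos d with rfl | hd
  · refine ⟨H.η₀, 0, 0, le_rfl, Subsingleton.elim _ _, Subsingleton.elim _ _, fun v => ?_, ?_⟩
    · have : v = 0 := Subsingleton.elim _ _
      simp [this]
    · simp
  · have : NeZero d := ⟨hd.ne'⟩
    exact exists_coupling_aux H ht x y hxy

lemma deriv_nonneg_of_left_max {φ : ℝ → ℝ} {c τ : ℝ} (hτ : 0 < τ) (h : HasDerivAt φ c τ)
    (hm : ∀ r ∈ Ioc 0 τ, φ r ≤ φ τ) : 0 ≤ c := by
  have h1 := (hasDerivAt_iff_tendsto_slope.mp h).mono_left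
    (nhdsWithin_mono τ (fun r (hr : r ∈ Iio τ) => (ne_of_lt hr : r ≠ τ)))
  refine ge_of_tendsto h1 ?_
  filter_upwards [Ioo_mem_nhdsLT hτ] with r hr
  rw [slope_def_field]
  exact div_nonneg_of_nonpos (by linarith [hm r ⟨hr.1, hr.2.le⟩]) (by linarith [hr.2])

/-- the logarithmic Lyapunov function -/
def logV {d : ℕ} (H : Hypotheses d) (x : Ed d) : ℝ := Real.log (1 + H.V x)

/-- the two-point function -/
def Phi {d : ℕ} (H : Hypotheses d) (u g : ℝ → Ed d → ℝ) (s β δ ε : ℝ) (τ : ℝ) (x y : Ed d) : ℝ :=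
  u (s + τ) x ^ 2 - g (s + τ) y + (2 * β / δ) * (u (s + τ) y - u (s + τ) x)
    - (δ ^ 2 * τ)⁻¹ * ‖x - y‖ ^ 2 - ε * (logV H x + logV H y) - ε * (2 * H.a + 1) * τ

lemma jet_logV {d : ℕ} (H : Hypotheses d) (x a : Ed d) :
    Jet (fun r => logV H (x + r • a)) (fderiv ℝ H.V x a / (1 + H.V x))
      (fderiv ℝ (fderiv ℝ H.V) x a a / (1 + H.V x) - (fderiv ℝ H.V x a / (1 + H.V x)) ^ 2) := by
  have hc : Jet (fun _ => (1:ℝ)) 0 0 :=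
    ⟨fun _ => 0, fun r => hasDerivAt_const r 1, hasDerivAt_const 0 0, rfl⟩
  have h := (hc.add (jet_line H.V_C2 x a)).log
    (fun r => by have := H.V_pos (x + r • a); linarith)
  simpa [logV] using h

lemma jet_normsq {d : ℕ} (x y a b : Ed d) :
    Jet (fun r : ℝ => ‖(x + r • a) - (y + r • b)‖ ^ 2) (2 * inner ℝ (x - y) (a - b))
      (2 * ‖a - b‖ ^ 2) := by
  have he : (fun r : ℝ => ‖(x + r • a) - (y + r • b)‖ ^ 2) =
      fun r => ‖x - y‖ ^ 2 + 2 * inner ℝ (x - y) (a - b) * r + ‖a - b‖ ^ 2 * r ^ 2 := by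
    funext r
    have : (x + r • a) - (y + r • b) = (x - y) + r • (a - b) := by rw [smul_sub]; abel
    rw [this, norm_add_sq_real, inner_smul_right, norm_smul, mul_pow, Real.norm_eq_abs, sq_abs]
    ring
  rw [he]
  refine ⟨fun r => 2 * inner ℝ (x - y) (a - b) + 2 * ‖a - b‖ ^ 2 * r, fun r => ?_, ?_, by simp⟩
  · have h1 := ((hasDerivAt_id r).const_mul (2 * inner ℝ (x - y) (a - b))).const_add (‖x - y‖ ^ 2)
    have h2 := (hasDerivAt_pow 2 r).const_mul (‖a - b‖ ^ 2)
    have := h1.add h2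
    refine this.congr_deriv ?_
    simp; ring
  · have h1 := ((hasDerivAt_id (0:ℝ)).const_mul (2 * ‖a - b‖ ^ 2)).const_add
      (2 * inner ℝ (x - y) (a - b))
    simpa using h1

lemma jet_Phi {d : ℕ} (H : Hypotheses d) (u g : ℝ → Ed d → ℝ) (s β δ ε τ : ℝ)
    (hu : ContDiff ℝ 2 (u (s + τ))) (hg : ContDiff ℝ 2 (g (s + τ))) (x y a b : Ed d) :
    Jet (fun r : ℝ => Phi H u g s β δ ε τ (x + r • a) (y + r • b))
      (2 * u (s + τ) x * fderiv ℝ (u (s + τ)) x a - fderiv ℝ (g (s + τ)) y b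
        + (2 * β / δ) * (fderiv ℝ (u (s + τ)) y b - fderiv ℝ (u (s + τ)) x a)
        - (δ ^ 2 * τ)⁻¹ * (2 * inner ℝ (x - y) (a - b))
        - ε * (fderiv ℝ H.V x a / (1 + H.V x) + fderiv ℝ H.V y b / (1 + H.V y)))
      (2 * u (s + τ) x * fderiv ℝ (fderiv ℝ (u (s + τ))) x a a
        + 2 * (fderiv ℝ (u (s + τ)) x a) ^ 2
        - fderiv ℝ (fderiv ℝ (g (s + τ))) y b b
        + (2 * β / δ) * (fderiv ℝ (fderiv ℝ (u (s + τ))) y b b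
          - fderiv ℝ (fderiv ℝ (u (s + τ))) x a a)
        - (δ ^ 2 * τ)⁻¹ * (2 * ‖a - b‖ ^ 2)
        - ε * ((fderiv ℝ (fderiv ℝ H.V) x a a / (1 + H.V x)
            - (fderiv ℝ H.V x a / (1 + H.V x)) ^ 2)
          + (fderiv ℝ (fderiv ℝ H.V) y b b / (1 + H.V y)
            - (fderiv ℝ H.V y b / (1 + H.V y)) ^ 2))) := by
  have hc : Jet (fun _ => ε * (2 * H.a + 1) * τ) 0 0 :=
    ⟨fun _ => 0, fun r => hasDerivAt_const r _, hasDerivAt_const 0 0, rfl⟩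
  have h := ((((((jet_line hu x a).sq.sub (jet_line hg y b)).add
    (((jet_line hu y b).sub (jet_line hu x a)).const_mul (2 * β / δ))).sub
    ((jet_normsq x y a b).const_mul ((δ ^ 2 * τ)⁻¹))).sub
    (((jet_logV H x a).add (jet_logV H y b)).const_mul ε)).sub hc)
  simpa [Phi] using h

lemma final_scalar {l G X E E' τ T c r N β δ ε S1 S2 : ℝ} (hl : 0 < l) (hE : 0 ≤ E)
    (hτ : 0 < τ) (hτT : τ ≤ T) (hc : 0 ≤ c) (hr : 0 ≤ r) (hε : 0 < ε)
    (hN : 1 + 2 * T * (c * l + r) ≤ N * l) (hβ : 4 * N * β ^ 2 ≤ 1) (hδ : N * δ ^ 2 * ε ≤ 2)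
    (hEle : E ≤ 8 * β ^ 2 * G ^ 2 + δ ^ 2 * ε ^ 2 / 2 * X ^ 2)
    (hE' : E' ≤ 2 * τ * E * (c * l + r)) (h1 : l * G ^ 2 ≤ S1) (h2 : l * X ^ 2 ≤ S2)
    (h : 0 ≤ -2 * S1 + E + E' - ε * S2 - ε) : False := by
  have hT : 0 < T := hτ.trans_le hτT
  have hcl : 0 ≤ c * l + r := by positivity
  have a1 : 2 * τ * E * (c * l + r) ≤ 2 * T * E * (c * l + r) := by gcongr
  have a2 : E * (1 + 2 * T * (c * l + r)) ≤ E * (N * l) := mul_le_mul_of_nonneg_left hN hE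
  have hNl : 0 ≤ N * l := le_trans (by positivity) hN
  have a3 : E * (N * l) ≤ (8 * β ^ 2 * G ^ 2 + δ ^ 2 * ε ^ 2 / 2 * X ^ 2) * (N * l) :=
    mul_le_mul_of_nonneg_right hEle hNl
  have a4 : (4 * N * β ^ 2) * (2 * l * G ^ 2) ≤ 1 * (2 * l * G ^ 2) :=
    mul_le_mul_of_nonneg_right hβ (by positivity)
  have a5 : (N * δ ^ 2 * ε) * (ε * l * X ^ 2 / 2) ≤ 2 * (ε * l * X ^ 2 / 2) :=
    mul_le_mul_of_nonneg_right hδ (by positivity)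
  have a6 : ε * (l * X ^ 2) ≤ ε * S2 := mul_le_mul_of_nonneg_left h2 hε.le
  nlinarith

set_option maxHeartbeats 1000000 in
lemma no_max {d : ℕ} (H : Hypotheses d) {s : ℝ} (hs : 0 ≤ s) {f g₀ : Ed d → ℝ}
    {u g : ℝ → Ed d → ℝ} (hu : IsBoundedClassicalSolution H.q H.b s f u)
    (hg : IsBoundedClassicalSolution H.q H.b s g₀ g) {T N M β δ ε : ℝ}
    (hβ0 : 0 < β) (hδ0 : 0 < δ) (hε0 : 0 < ε)
    (hN : ∀ l, H.η₀ ≤ l →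
      1 + 2 * T * (((d : ℝ) * H.c₀ * Real.exp H.c₀) ^ 2 * l + |H.r₀|) ≤ N * l)
    (hβ : 4 * N * β ^ 2 ≤ 1) (hδ : N * δ ^ 2 * ε ≤ 2) (hδM : δ * M ≤ β)
    {τ : ℝ} (hτ : 0 < τ) (hτT : τ ≤ T) {x y : Ed d} (hM : |u (s + τ) x| ≤ M)
    (hxy : ‖x - y‖ ≤ 1)
    (hmax : ∀ τ' ∈ Ioc 0 T, ∀ x' y', Phi H u g s β δ ε τ' x' y' ≤ Phi H u g s β δ ε τ x y) :
    False := by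
  have ht : s + τ ∈ Ici (0:ℝ) := by simp only [mem_Ici]; linarith
  have hst : s + τ ∈ Ioi s := by simp only [mem_Ioi]; linarith
  obtain ⟨l, A, B, hl, hA, hB, hlow, hAB⟩ := exists_coupling H ht x y hxy
  have hl0 : 0 < l := H.hη₀.trans_le hl
  have hVx := H.V_pos x
  have hVy := H.V_pos y
  have hjet := jet_Phi H u g s β δ ε τ (hu.smooth_space _ hst) (hg.smooth_space _ hst) x y
  have hmx : ∀ a b : Ed d, ∀ r : ℝ, (fun r : ℝ => Phi H u g s β δ ε τ (x + r • a) (y + r • b)) r ≤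
      (fun r : ℝ => Phi H u g s β δ ε τ (x + r • a) (y + r • b)) 0 := by
    intro a b r
    simpa using hmax τ ⟨hτ, hτT⟩ (x + r • a) (y + r • b)
  have hfirst := fun a b => (hjet a b).first (hmx a b)
  have hsecond := fun a b => (hjet a b).second (hmx a b)
  -- time derivative
  have hsum : ∀ {w : ℝ → Ed d → ℝ} {w₀ : Ed d → ℝ}, IsBoundedClassicalSolution H.q H.b s w₀ w →
      ∀ z, HasDerivAt (fun r => w (s + r) z) (applyA H.q H.b (s + τ) (w (s + τ)) z) τ := by
    intro w w₀ hw z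
    exact (hw.pde _ hst z).comp_const_add s τ
  have htime : 0 ≤ 2 * u (s + τ) x * applyA H.q H.b (s + τ) (u (s + τ)) x
      - applyA H.q H.b (s + τ) (g (s + τ)) y
      + (2 * β / δ) * (applyA H.q H.b (s + τ) (u (s + τ)) y
        - applyA H.q H.b (s + τ) (u (s + τ)) x)
      + (δ ^ 2 * τ ^ 2)⁻¹ * ‖x - y‖ ^ 2 - ε * (2 * H.a + 1) := by
    have hinv : HasDerivAt (fun r : ℝ => (δ ^ 2 * r)⁻¹) (-(δ ^ 2 * τ ^ 2)⁻¹) τ := by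
      have h1 := ((hasDerivAt_id τ).const_mul (δ ^ 2)).inv (by simp; constructor <;> positivity)
      refine h1.congr_deriv ?_
      simp only [id]
      field_simp
    have h1 := ((((((hsum hu x).fun_pow 2).sub (hsum hg y)).add
      (((hsum hu y).sub (hsum hu x)).const_mul (2 * β / δ))).sub
      (hinv.mul_const (‖x - y‖ ^ 2))).sub_const (ε * (logV H x + logV H y))).sub
      ((hasDerivAt_id τ).const_mul (ε * (2 * H.a + 1)))
    have h2 := deriv_nonneg_of_left_max (φ := fun r => Phi H u g s β δ ε r x y) hτ h1
      (fun r hr => hmax r ⟨hr.1, hr.2.trans hτT⟩ x y)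
    simp only [Nat.cast_ofNat, Nat.add_one_sub_one, pow_one] at h2
    linarith
  -- sum of second derivatives
  have hss := Finset.sum_nonpos fun m (_ : m ∈ (Finset.univ : Finset (Fin d))) =>
    hsecond (colv A m) (colv B m)
  have hdrift := hfirst (H.b (s + τ) x) (H.b (s + τ) y)
  simp only [Finset.sum_add_distrib, Finset.sum_sub_distrib, ← Finset.mul_sum, ← Finset.sum_div]
    at hss
  rw [applyA_eq _ _ _ _ x A hA, applyA_eq _ _ _ _ y B hB, applyA_eq _ _ _ _ y B hB] at htime
  have hly : ∀ (z : Ed d) (C : Matrix (Fin d) (Fin d) ℝ), C * C.transpose = H.q (s + τ) z →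
      (∑ m, fderiv ℝ (fderiv ℝ H.V) z (colv C m) (colv C m)) / (1 + H.V z)
        + fderiv ℝ H.V z (H.b (s + τ) z) / (1 + H.V z) ≤ H.a := by
    intro z C hC
    have h1 := H.lyapunov (s + τ) ht z
    rw [applyA_eq _ _ _ _ z C hC] at h1
    have hz := H.V_pos z
    rw [← add_div, div_le_iff₀ (by linarith)]
    nlinarith [H.ha, H.hκ, mul_nonneg H.ha hz.le, mul_pos H.hκ hz]
  have hlx := hly x A hA
  have hly' := hly y B hB
  -- gradients
  set p := gradient (u (s + τ)) x with hp
  set w := (1 + H.V x)⁻¹ • gradient H.V x with hw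
  have hpa : ∀ v, fderiv ℝ (u (s + τ)) x v = inner ℝ p v := fun v => by
    rw [hp, inner_gradient_left]
  have hwa : ∀ v, fderiv ℝ H.V x v / (1 + H.V x) = inner ℝ w v := fun v => by
    rw [hw, inner_smul_left, inner_gradient_left]; simp; ring
  have hS1 := hlow p
  have hS2 := hlow w
  simp only [← hpa, ← hwa] at hS1 hS2
  have hSy : 0 ≤ ∑ m, (fderiv ℝ H.V y (colv B m) / (1 + H.V y)) ^ 2 :=
    Finset.sum_nonneg fun _ _ => sq_nonneg _
  have hbd := b_diss H ht x y
  rw [real_inner_comm] at hbd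
  -- first order condition
  have hvec : (δ ^ 2 * τ)⁻¹ • (x - y) = (u (s + τ) x - β / δ) • p - (ε / 2) • w := by
    refine ext_inner_right ℝ fun v => ?_
    have := hfirst v 0
    rw [hwa, hpa] at this
    simp only [map_zero, sub_zero, zero_div, zero_sub, add_zero] at this
    rw [inner_sub_left, inner_smul_left, inner_smul_left, inner_smul_left]
    simp only [conj_trivial]
    linear_combination (-1 / 2) * this
  have hnorm : ‖x - y‖ / (δ * τ) ≤ 2 * β * ‖p‖ + δ * ε / 2 * ‖w‖ := by
    have h1 : ‖(δ ^ 2 * τ)⁻¹ • (x - y)‖ = (δ ^ 2 * τ)⁻¹ * ‖x - y‖ := by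
      rw [norm_smul, Real.norm_of_nonneg (by positivity)]
    have h2 : ‖(u (s + τ) x - β / δ) • p - (ε / 2) • w‖ ≤ (M + β / δ) * ‖p‖ + ε / 2 * ‖w‖ := by
      refine (norm_sub_le _ _).trans ?_
      rw [norm_smul, norm_smul, Real.norm_of_nonneg (show 0 ≤ ε / 2 by positivity)]
      gcongr
      refine (norm_sub_le _ _).trans ?_
      rw [Real.norm_of_nonneg (show 0 ≤ β / δ by positivity)]
      gcongr
      exact hM
    rw [← hvec, h1] at h2
    have h3 := mul_le_mul_of_nonneg_left h2 hδ0.le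
    have h4 : δ * ((δ ^ 2 * τ)⁻¹ * ‖x - y‖) = ‖x - y‖ / (δ * τ) := by field_simp
    have h5 : δ * ((M + β / δ) * ‖p‖ + ε / 2 * ‖w‖) =
        (δ * M + β) * ‖p‖ + δ * ε / 2 * ‖w‖ := by field_simp
    rw [h4, h5] at h3
    have h6 : (δ * M + β) * ‖p‖ ≤ (2 * β) * ‖p‖ :=
      mul_le_mul_of_nonneg_right (by linarith) (norm_nonneg _)
    linarith
  set E := (δ ^ 2 * τ ^ 2)⁻¹ * ‖x - y‖ ^ 2 with hE
  have hE2 : E = (‖x - y‖ / (δ * τ)) ^ 2 := by rw [hE]; field_simp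
  have hEle : E ≤ 8 * β ^ 2 * ‖p‖ ^ 2 + δ ^ 2 * ε ^ 2 / 2 * ‖w‖ ^ 2 := by
    rw [hE2]
    have h0 : 0 ≤ ‖x - y‖ / (δ * τ) := by positivity
    have h1 := pow_le_pow_left₀ h0 hnorm 2
    nlinarith [sq_nonneg (2 * β * ‖p‖ - δ * ε / 2 * ‖w‖)]
  have hPE : (δ ^ 2 * τ)⁻¹ * ‖x - y‖ ^ 2 = τ * E := by rw [hE]; field_simp
  have hP0 : 0 ≤ (δ ^ 2 * τ)⁻¹ := by positivity
  refine final_scalar (E' := (δ ^ 2 * τ)⁻¹ * (2 * ∑ m, ‖colv A m - colv B m‖ ^ 2)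
      + (δ ^ 2 * τ)⁻¹ * (2 * inner ℝ (x - y) (H.b (s + τ) x - H.b (s + τ) y)))
    hl0 (by rw [hE2]; positivity) hτ hτT
    (sq_nonneg ((d : ℝ) * H.c₀ * Real.exp H.c₀)) (abs_nonneg H.r₀) hε0 (hN l hl) hβ hδ hEle ?_
    hS1 hS2 ?_
  · have h1 : inner ℝ (x - y) (H.b (s + τ) x - H.b (s + τ) y) ≤ |H.r₀| * ‖x - y‖ ^ 2 :=
      hbd.trans (mul_le_mul_of_nonneg_right (le_abs_self _) (sq_nonneg _))
    have h2 := mul_le_mul_of_nonneg_left (add_le_add hAB h1) hP0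
    have h3 : (δ ^ 2 * τ)⁻¹ * ((((d : ℝ) * H.c₀ * Real.exp H.c₀) ^ 2 * l * ‖x - y‖ ^ 2)
        + |H.r₀| * ‖x - y‖ ^ 2) = τ * E * (((d : ℝ) * H.c₀ * Real.exp H.c₀) ^ 2 * l + |H.r₀|) := by
      rw [← hPE]; ring
    rw [h3] at h2
    linarith
  · have e1 := mul_le_mul_of_nonneg_left (add_le_add hlx hly') hε0.le
    have e2 := mul_nonneg hε0.le hSy
    linear_combination htime + hss + hdrift + e1 + e2

lemma logV_nonneg {d : ℕ} (H : Hypotheses d) (x : Ed d) : 0 ≤ logV H x :=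
  Real.log_nonneg (by have := H.V_pos x; linarith)

lemma logV_cont {d : ℕ} (H : Hypotheses d) : Continuous (logV H) := by
  unfold logV
  refine Continuous.log (f := fun x => 1 + H.V x) (continuous_const.add H.V_C2.continuous)
    fun x => ?_
  have := H.V_pos x
  exact (by linarith : (0:ℝ) < 1 + H.V x).ne'

lemma logV_compact {d : ℕ} (H : Hypotheses d) (C : ℝ) : IsCompact {x | logV H x ≤ C} := by
  have h1 : Tendsto (logV H) (cocompact (Ed d)) atTop := by
    rw [← cobounded_eq_cocompact, ← comap_norm_atTop]
    exact Real.tendsto_log_atTop.comp (tendsto_atTop_add_const_left _ 1 H.V_tendsto)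
  have h2 := h1.eventually (eventually_gt_atTop C)
  obtain ⟨t, ht, hts⟩ := mem_cocompact.mp h2
  refine ht.of_isClosed_subset (isClosed_le (logV_cont H) continuous_const) ?_
  intro x hx
  by_contra hxt
  have : C < logV H x := hts hxt
  exact absurd hx (not_le.mpr this)

lemma ext_cont {d : ℕ} {H : Hypotheses d} {s : ℝ} {f : Ed d → ℝ} {u : ℝ → Ed d → ℝ}
    (hu : IsBoundedClassicalSolution H.q H.b s f u) :
    Continuous (fun z : ℝ × Ed d => u (s + max z.1 0) z.2) := by
  have h := hu.cont.comp_continuous (f := fun z : ℝ × Ed d => (s + max z.1 0, z.2)) (by fun_prop)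
    (fun z => by simp)
  exact h

set_option maxHeartbeats 1000000 in
lemma Phi_le {d : ℕ} (H : Hypotheses d) {s : ℝ} (hs : 0 ≤ s) {f g₀ : Ed d → ℝ}
    {u g : ℝ → Ed d → ℝ} (hu : IsBoundedClassicalSolution H.q H.b s f u)
    (hg : IsBoundedClassicalSolution H.q H.b s g₀ g) (hfg : ∀ x, f x ^ 2 ≤ g₀ x)
    {T N M β δ ε : ℝ}
    (hβ0 : 0 < β) (hδ0 : 0 < δ) (hε0 : 0 < ε)
    (hN : ∀ l, H.η₀ ≤ l →
      1 + 2 * T * (((d : ℝ) * H.c₀ * Real.exp H.c₀) ^ 2 * l + |H.r₀|) ≤ N * l)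
    (hβ : 4 * N * β ^ 2 ≤ 1) (hδ : N * δ ^ 2 * ε ≤ 2) (hδM : δ * M ≤ β)
    (hδT : T * (δ ^ 2 * (M ^ 2 + M) + 4 * β * M * δ) ≤ 1)
    (hMu : ∀ t ∈ Ici s, ∀ x, |u t x| ≤ M) (hMg : ∀ t ∈ Ici s, ∀ x, |g t x| ≤ M)
    {τ : ℝ} (hτ : τ ∈ Ioc 0 T) (x y : Ed d) : Phi H u g s β δ ε τ x y ≤ 0 := by
  by_contra hcon
  push Not at hcon
  set c := Phi H u g s β δ ε τ x y with hc
  set Nf : ℝ × Ed d × Ed d → ℝ := fun z =>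
    u (s + max z.1 0) z.2.1 ^ 2 - g (s + max z.1 0) z.2.2
      + (2 * β / δ) * (u (s + max z.1 0) z.2.2 - u (s + max z.1 0) z.2.1)
      - ε * (logV H z.2.1 + logV H z.2.2) - ε * (2 * H.a + 1) * z.1 with hNf
  have hWc := logV_cont H
  have hNc : Continuous Nf := by
    have c1 : Continuous (fun z : ℝ × Ed d × Ed d => u (s + max z.1 0) z.2.1) :=
      (ext_cont hu).comp (g := fun z : ℝ × Ed d => u (s + max z.1 0) z.2)
        (f := fun z : ℝ × Ed d × Ed d => (z.1, z.2.1)) (by fun_prop)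
    have c2 : Continuous (fun z : ℝ × Ed d × Ed d => u (s + max z.1 0) z.2.2) :=
      (ext_cont hu).comp (g := fun z : ℝ × Ed d => u (s + max z.1 0) z.2)
        (f := fun z : ℝ × Ed d × Ed d => (z.1, z.2.2)) (by fun_prop)
    have c3 : Continuous (fun z : ℝ × Ed d × Ed d => g (s + max z.1 0) z.2.2) :=
      (ext_cont hg).comp (g := fun z : ℝ × Ed d => g (s + max z.1 0) z.2)
        (f := fun z : ℝ × Ed d × Ed d => (z.1, z.2.2)) (by fun_prop)
    have c4 : Continuous (fun z : ℝ × Ed d × Ed d => logV H z.2.1) := hWc.comp (by fun_prop)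
    have c5 : Continuous (fun z : ℝ × Ed d × Ed d => logV H z.2.2) := hWc.comp (by fun_prop)
    exact ((((c1.pow 2).sub c3).add ((c2.sub c1).const_mul _)).sub ((c4.add c5).const_mul ε)).sub
      (continuous_fst.const_mul _)
  have hPN : ∀ r, 0 < r → ∀ x' y', Phi H u g s β δ ε r x' y' =
      Nf (r, x', y') - (δ ^ 2 * r)⁻¹ * ‖x' - y'‖ ^ 2 := by
    intro r hr x' y'
    simp only [Phi, hNf, max_eq_left hr.le]
    ring
  have hM0 : 0 ≤ M := (abs_nonneg _).trans (hMu s (by simp) x)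
  set C := M ^ 2 + M + (2 * β / δ) * (2 * M) with hC
  have hmem : ∀ r : ℝ, s + max r 0 ∈ Ici s := fun r => by simp
  have hNle : ∀ z : ℝ × Ed d × Ed d, 0 ≤ z.1 →
      Nf z ≤ C - ε * (logV H z.2.1 + logV H z.2.2) := by
    intro z hz
    have h1 := hMu _ (hmem z.1) z.2.1
    have h2 := hMu _ (hmem z.1) z.2.2
    have h3 := hMg _ (hmem z.1) z.2.2
    have h4 : u (s + max z.1 0) z.2.1 ^ 2 ≤ M ^ 2 := by
      rw [← sq_abs]; exact pow_le_pow_left₀ (abs_nonneg _) h1 2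
    have h5 : (2 * β / δ) * (u (s + max z.1 0) z.2.2 - u (s + max z.1 0) z.2.1)
        ≤ (2 * β / δ) * (2 * M) := by
      refine mul_le_mul_of_nonneg_left ?_ (by positivity)
      linarith [(abs_le.mp h1).1, (abs_le.mp h2).2]
    have h6 : 0 ≤ ε * (2 * H.a + 1) * z.1 := by have := H.ha; positivity
    simp only [hNf, hC]
    linarith [(abs_le.mp h3).1]
  set S : Set (ℝ × Ed d × Ed d) := {z | (0 ≤ z.1 ∧ z.1 ≤ T) ∧ c ≤ Nf z ∧
    c * z.1 + (δ ^ 2)⁻¹ * ‖z.2.1 - z.2.2‖ ^ 2 ≤ z.1 * Nf z} with hS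
  have hSclosed : IsClosed S := by
    refine IsClosed.inter (IsClosed.inter ?_ ?_) (IsClosed.inter ?_ ?_)
    · exact isClosed_le continuous_const continuous_fst
    · exact isClosed_le continuous_fst continuous_const
    · exact isClosed_le continuous_const hNc
    · have c6 : Continuous (fun z : ℝ × Ed d × Ed d =>
          c * z.1 + (δ ^ 2)⁻¹ * ‖z.2.1 - z.2.2‖ ^ 2) := by fun_prop
      have c7 : Continuous (fun z : ℝ × Ed d × Ed d => z.1 * Nf z) := continuous_fst.mul hNc
      exact isClosed_le c6 c7
  have hScompact : IsCompact S := by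
    have hK := logV_compact H (C / ε)
    refine ((isCompact_Icc (a := (0:ℝ)) (b := T)).prod (hK.prod hK)).of_isClosed_subset hSclosed ?_
    rintro z ⟨⟨h0, hT⟩, h1, -⟩
    have h2 := hNle z h0
    have hx := logV_nonneg H z.2.1
    have hy := logV_nonneg H z.2.2
    refine ⟨⟨h0, hT⟩, ?_, ?_⟩
    · show logV H z.2.1 ≤ C / ε
      rw [le_div_iff₀ hε0]; nlinarith
    · show logV H z.2.2 ≤ C / ε
      rw [le_div_iff₀ hε0]; nlinarith
  have hSpos : ∀ z ∈ S, 0 < z.1 := by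
    rintro z ⟨⟨h0, hT⟩, h1, h2⟩
    refine lt_of_le_of_ne h0 fun h => ?_
    rw [← h] at h2
    have h3 : (δ ^ 2)⁻¹ * ‖z.2.1 - z.2.2‖ ^ 2 ≤ 0 := by simpa using h2
    have h4 : z.2.1 = z.2.2 := by
      by_contra hne
      have : 0 < ‖z.2.1 - z.2.2‖ := norm_pos_iff.mpr (sub_ne_zero.mpr hne)
      have : 0 < (δ ^ 2)⁻¹ * ‖z.2.1 - z.2.2‖ ^ 2 := by positivity
      linarith
    have h5 : Nf z ≤ 0 := by
      have e1 := hu.init z.2.2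
      have e2 := hg.init z.2.2
      have e3 := hfg z.2.2
      have e4 := mul_nonneg hε0.le (logV_nonneg H z.2.2)
      simp only [hNf, ← h, h4, max_self, add_zero, e1, e2, mul_zero, sub_self, sub_zero]
      linarith
    linarith
  have hin : ∀ r ∈ Ioc 0 T, ∀ x' y', c ≤ Phi H u g s β δ ε r x' y' → (r, x', y') ∈ S := by
    intro r hr x' y' h
    rw [hPN r hr.1] at h
    have hnn : 0 ≤ (δ ^ 2 * r)⁻¹ * ‖x' - y'‖ ^ 2 := by have := hr.1; positivity
    refine ⟨⟨hr.1.le, hr.2⟩, by linarith, ?_⟩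
    have h1 := mul_le_mul_of_nonneg_left h hr.1.le
    have h2 : r * ((δ ^ 2 * r)⁻¹ * ‖x' - y'‖ ^ 2) = (δ ^ 2)⁻¹ * ‖x' - y'‖ ^ 2 := by
      have := hr.1.ne'
      field_simp
    show c * r + (δ ^ 2)⁻¹ * ‖x' - y'‖ ^ 2 ≤ r * Nf (r, x', y')
    rw [mul_sub, h2] at h1
    linarith
  have hPc : ContinuousOn (fun z : ℝ × Ed d × Ed d => Phi H u g s β δ ε z.1 z.2.1 z.2.2) S := by
    have : ContinuousOn (fun z : ℝ × Ed d × Ed d =>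
        Nf z - (δ ^ 2 * z.1)⁻¹ * ‖z.2.1 - z.2.2‖ ^ 2) S := by
      refine hNc.continuousOn.sub (ContinuousOn.mul (ContinuousOn.inv₀ (by fun_prop) ?_)
        (by fun_prop))
      intro z hz
      have := hSpos z hz
      positivity
    exact this.congr fun z hz => hPN z.1 (hSpos z hz) z.2.1 z.2.2
  obtain ⟨z, hz, hzmax⟩ := hScompact.exists_isMaxOn ⟨_, hin τ hτ x y le_rfl⟩ hPc
  have hz0 := hSpos z hz
  have hcz : c ≤ Phi H u g s β δ ε z.1 z.2.1 z.2.2 := hzmax (hin τ hτ x y le_rfl)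
  have hzT : z.1 ≤ T := hz.1.2
  refine no_max H hs hu hg hβ0 hδ0 hε0 hN hβ hδ hδM hz0 hzT (x := z.2.1) (y := z.2.2)
    (hMu _ (by simp only [mem_Ici]; linarith) _) ?_ ?_
  · have h1 := hPN z.1 hz0 z.2.1 z.2.2
    have h2 := hNle z hz0.le
    have h3 := mul_nonneg hε0.le (add_nonneg (logV_nonneg H z.2.1) (logV_nonneg H z.2.2))
    have h4 : (δ ^ 2 * z.1)⁻¹ * ‖z.2.1 - z.2.2‖ ^ 2 ≤ C := by
      have : Nf z = Nf (z.1, z.2.1, z.2.2) := rfl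
      linarith
    rw [inv_mul_le_iff₀ (by positivity)] at h4
    have h5 : δ ^ 2 * z.1 * C = z.1 * (δ ^ 2 * (M ^ 2 + M) + 4 * β * M * δ) := by
      rw [hC]; field_simp; ring
    have h6 : z.1 * (δ ^ 2 * (M ^ 2 + M) + 4 * β * M * δ)
        ≤ T * (δ ^ 2 * (M ^ 2 + M) + 4 * β * M * δ) :=
      mul_le_mul_of_nonneg_right hzT (by positivity)
    have h7 : ‖z.2.1 - z.2.2‖ ^ 2 ≤ 1 := by linarith
    exact (sq_le_one_iff₀ (norm_nonneg _)).mp h7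
  · intro r hr x' y'
    by_cases h : c ≤ Phi H u g s β δ ε r x' y'
    · exact hzmax (hin r hr x' y' h)
    · linarith

/-- Basic estimate on a finite time horizon. -/
lemma basic_estimate {d : ℕ} (H : Hypotheses d) {s : ℝ} (hs : 0 ≤ s) {f g₀ : Ed d → ℝ}
    {u g : ℝ → Ed d → ℝ} (hu : IsBoundedClassicalSolution H.q H.b s f u)
    (hg : IsBoundedClassicalSolution H.q H.b s g₀ g) (hfg : ∀ x, f x ^ 2 ≤ g₀ x)
    {T N β : ℝ} (hβ0 : 0 < β)
    (hN : ∀ l, H.η₀ ≤ l →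
      1 + 2 * T * (((d : ℝ) * H.c₀ * Real.exp H.c₀) ^ 2 * l + |H.r₀|) ≤ N * l)
    (hN0 : 0 ≤ N) (hβ : 4 * N * β ^ 2 ≤ 1)
    {τ : ℝ} (hτ : τ ∈ Ioc 0 T) (x : Ed d) :
    u (s + τ) x ^ 2 + β ^ 2 * τ * ‖gradient (u (s + τ)) x‖ ^ 2 ≤ g (s + τ) x := by
  obtain ⟨M1, hM1⟩ := hu.bdd
  obtain ⟨M2, hM2⟩ := hg.bdd
  set M := max M1 M2
  have hMu : ∀ t ∈ Ici s, ∀ x, |u t x| ≤ M := fun t ht x => (hM1 t ht x).trans (le_max_left _ _)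
  have hMg : ∀ t ∈ Ici s, ∀ x, |g t x| ≤ M := fun t ht x => (hM2 t ht x).trans (le_max_right _ _)
  have hst : s + τ ∈ Ioi s := by simp only [mem_Ioi]; linarith [hτ.1]
  set k : Ed d := (τ * β) • gradient (u (s + τ)) x with hk
  -- smallness of δ
  have hev : ∀ᶠ δ : ℝ in 𝓝[>] 0, 0 < δ ∧ N * δ ^ 2 < 2 ∧ δ * M < β ∧
      T * (δ ^ 2 * (M ^ 2 + M) + 4 * β * M * δ) < 1 := by
    refine (eventually_mem_nhdsWithin).and (nhdsWithin_le_nhds ?_)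
    have c1 : ContinuousAt (fun δ : ℝ => N * δ ^ 2) 0 := by fun_prop
    have c2 : ContinuousAt (fun δ : ℝ => δ * M) 0 := by fun_prop
    have c3 : ContinuousAt (fun δ : ℝ => T * (δ ^ 2 * (M ^ 2 + M) + 4 * β * M * δ)) 0 := by fun_prop
    exact (c1.eventually_lt continuousAt_const (by simp)).and
      ((c2.eventually_lt continuousAt_const (by simpa using hβ0)).and
        (c3.eventually_lt continuousAt_const (by simp)))
  have hineq : ∀ᶠ δ : ℝ in 𝓝[>] 0, u (s + τ) x ^ 2 - g (s + τ) (x + δ • k)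
      + (2 * β) * ((δ)⁻¹ • (u (s + τ) (x + δ • k) - u (s + τ) x)) - τ⁻¹ * ‖k‖ ^ 2 ≤ 0 := by
    filter_upwards [hev] with δ ⟨hδ0, h1, h2, h3⟩
    have hε : ∀ᶠ ε : ℝ in 𝓝[>] 0, Phi H u g s β δ ε τ x (x + δ • k) ≤ 0 := by
      filter_upwards [Ioo_mem_nhdsGT (zero_lt_one (α := ℝ))] with ε hε
      refine Phi_le H hs hu hg hfg hβ0 hδ0 hε.1 hN hβ ?_ h2.le h3.le hMu hMg hτ _ _
      have : 0 ≤ N * δ ^ 2 := by positivity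
      nlinarith [hε.1, hε.2]
    have hlim : Tendsto (fun ε => Phi H u g s β δ ε τ x (x + δ • k)) (𝓝[>] 0)
        (𝓝 (Phi H u g s β δ 0 τ x (x + δ • k))) := by
      have : Continuous (fun ε => Phi H u g s β δ ε τ x (x + δ • k)) := by
        unfold Phi; fun_prop
      exact (this.tendsto 0).mono_left nhdsWithin_le_nhds
    have h4 := le_of_tendsto hlim hε
    have h5 : ‖x - (x + δ • k)‖ ^ 2 = δ ^ 2 * ‖k‖ ^ 2 := by
      rw [sub_add_cancel_left, norm_neg, norm_smul, mul_pow, Real.norm_eq_abs, sq_abs]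
    have hτ0 := hτ.1.ne'
    have h6 : (δ ^ 2 * τ)⁻¹ * (δ ^ 2 * ‖k‖ ^ 2) = τ⁻¹ * ‖k‖ ^ 2 := by
      field_simp
    simp only [Phi, h5, h6, zero_mul, sub_zero] at h4
    rw [smul_eq_mul]
    have h7 : 2 * β * (δ⁻¹ * (u (s + τ) (x + δ • k) - u (s + τ) x))
        = 2 * β / δ * (u (s + τ) (x + δ • k) - u (s + τ) x) := by ring
    rw [h7]
    exact h4
  have hlim : Tendsto (fun δ : ℝ => u (s + τ) x ^ 2 - g (s + τ) (x + δ • k)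
      + (2 * β) * ((δ)⁻¹ • (u (s + τ) (x + δ • k) - u (s + τ) x)) - τ⁻¹ * ‖k‖ ^ 2) (𝓝[>] 0)
      (𝓝 (u (s + τ) x ^ 2 - g (s + τ) x + (2 * β) * (fderiv ℝ (u (s + τ)) x k)
        - τ⁻¹ * ‖k‖ ^ 2)) := by
    have hgc : Continuous (fun δ : ℝ => g (s + τ) (x + δ • k)) :=
      (hg.smooth_space _ hst).continuous.comp (by fun_prop)
    have t1 : Tendsto (fun δ : ℝ => g (s + τ) (x + δ • k)) (𝓝[>] 0) (𝓝 (g (s + τ) x)) := by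
      have := (hgc.tendsto 0).mono_left (nhdsWithin_le_nhds (s := Ioi (0:ℝ)))
      simpa using this
    have t2 : Tendsto (fun δ : ℝ => (δ)⁻¹ • (u (s + τ) (x + δ • k) - u (s + τ) x)) (𝓝[>] 0)
        (𝓝 (fderiv ℝ (u (s + τ)) x k)) := by
      have h1 := (jet_line (hu.smooth_space _ hst) x k).hasDerivAt
      have h2 := h1.tendsto_slope_zero.mono_left
        (nhdsWithin_mono (0:ℝ) (fun r (hr : r ∈ Ioi 0) => (ne_of_gt hr : r ≠ 0)))
      simpa using h2
    exact ((tendsto_const_nhds.sub t1).add (t2.const_mul _)).sub tendsto_const_nhds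
  have hfin := le_of_tendsto hlim hineq
  have hgk : fderiv ℝ (u (s + τ)) x k = τ * β * ‖gradient (u (s + τ)) x‖ ^ 2 := by
    rw [← inner_gradient_left, hk, inner_smul_right, real_inner_self_eq_norm_sq]
  have hnk : τ⁻¹ * ‖k‖ ^ 2 = τ * β ^ 2 * ‖gradient (u (s + τ)) x‖ ^ 2 := by
    have := hτ.1
    rw [hk, norm_smul, mul_pow, Real.norm_eq_abs, sq_abs]
    field_simp
  rw [hgk, hnk] at hfin
  nlinarith

lemma applyA_comb {d : ℕ} (q : ℝ → Ed d → Matrix (Fin d) (Fin d) ℝ) (b : ℝ → Ed d → Ed d)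
    (t : ℝ) {g h : Ed d → ℝ} (hg : ContDiff ℝ 2 g) (hh : ContDiff ℝ 2 h) (c l : ℝ) (x : Ed d) :
    applyA q b t (fun y => g y - c - l * h y) x =
      applyA q b t g x - l * applyA q b t h x := by
  have dg : Differentiable ℝ g := hg.differentiable (by norm_num)
  have dh : Differentiable ℝ h := hh.differentiable (by norm_num)
  have dg2 : Differentiable ℝ (fderiv ℝ g) :=
    (hg.fderiv_right (m := 1) (by norm_num)).differentiable (by norm_num)
  have dh2 : Differentiable ℝ (fderiv ℝ h) :=
    (hh.fderiv_right (m := 1) (by norm_num)).differentiable (by norm_num)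
  have e1 : fderiv ℝ (fun y => g y - c - l * h y) = fun y => fderiv ℝ g y - l • fderiv ℝ h y := by
    funext y
    exact (((dg y).hasFDerivAt.sub_const c).sub ((dh y).hasFDerivAt.const_mul l)).fderiv
  have e2 : fderiv ℝ (fun y => fderiv ℝ g y - l • fderiv ℝ h y) x =
      fderiv ℝ (fderiv ℝ g) x - l • fderiv ℝ (fderiv ℝ h) x :=
    ((dg2 x).hasFDerivAt.sub ((dh2 x).hasFDerivAt.const_smul l)).fderiv
  have e3 : ∀ w : Ed d → ℝ, ⟪b t x, gradient w x⟫ = fderiv ℝ w x (b t x) := fun w => by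
    rw [real_inner_comm, inner_gradient_left]
  simp only [applyA, e3, iteratedFDeriv_two_apply, e1, e2]
  simp only [sub_apply, smul_apply, smul_eq_mul, mul_sub, Finset.sum_sub_distrib, mul_add,
    Finset.mul_sum]
  have : ∀ i j : Fin d, ∀ A : ℝ, q t x i j * (l * A) = l * (q t x i j * A) := by
    intros; ring
  simp only [this]
  ring

lemma sol_comb {d : ℕ} {q : ℝ → Ed d → Matrix (Fin d) (Fin d) ℝ} {b : ℝ → Ed d → Ed d}
    {s : ℝ} {g₀ h₀ : Ed d → ℝ} {g h : ℝ → Ed d → ℝ}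
    (hg : IsBoundedClassicalSolution q b s g₀ g) (hh : IsBoundedClassicalSolution q b s h₀ h)
    (c l : ℝ) :
    IsBoundedClassicalSolution q b s (fun x => g₀ x - c - l * h₀ x)
      (fun t x => g t x - c - l * h t x) where
  cont := (hg.cont.sub continuousOn_const).sub (hh.cont.const_mul l)
  bdd := by
    obtain ⟨M1, h1⟩ := hg.bdd
    obtain ⟨M2, h2⟩ := hh.bdd
    refine ⟨M1 + |c| + |l| * M2, fun t ht x => ?_⟩
    refine (abs_sub _ _).trans (add_le_add ((abs_sub _ _).trans (add_le_add (h1 t ht x) le_rfl)) ?_)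
    rw [abs_mul]
    exact mul_le_mul_of_nonneg_left (h2 t ht x) (abs_nonneg _)
  smooth_space := fun t ht =>
    ((hg.smooth_space t ht).sub contDiff_const).sub (contDiff_const.mul (hh.smooth_space t ht))
  pde := fun t ht x => by
    rw [applyA_comb q b t (hg.smooth_space t ht) (hh.smooth_space t ht)]
    exact ((hg.pde t ht x).sub_const c).sub ((hh.pde t ht x).const_mul l)
  init := fun x => by simp [hg.init, hh.init]

lemma sol_restrict {d : ℕ} {q : ℝ → Ed d → Matrix (Fin d) (Fin d) ℝ} {b : ℝ → Ed d → Ed d}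
    {s s' : ℝ} {g₀ : Ed d → ℝ} {g : ℝ → Ed d → ℝ}
    (hg : IsBoundedClassicalSolution q b s g₀ g) (h : s ≤ s') :
    IsBoundedClassicalSolution q b s' (g s') g where
  cont := hg.cont.mono (prod_mono (Ici_subset_Ici.mpr h) le_rfl)
  bdd := by
    obtain ⟨M, h1⟩ := hg.bdd
    exact ⟨M, fun t ht x => h1 t (h.trans ht) x⟩
  smooth_space := fun t ht => hg.smooth_space t (lt_of_le_of_lt h ht)
  pde := fun t ht x => hg.pde t (lt_of_le_of_lt h ht) x
  init := fun _ => rfl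

lemma exists_beta {d : ℕ} (H : Hypotheses d) {T : ℝ} (hT : 0 ≤ T) : ∃ N β : ℝ, 0 < β ∧ 0 ≤ N ∧
    4 * N * β ^ 2 ≤ 1 ∧ ∀ l, H.η₀ ≤ l →
      1 + 2 * T * (((d : ℝ) * H.c₀ * Real.exp H.c₀) ^ 2 * l + |H.r₀|) ≤ N * l := by
  have hη := H.hη₀
  set e := ((d : ℝ) * H.c₀ * Real.exp H.c₀) ^ 2 with he
  have he0 : 0 ≤ e := sq_nonneg _
  set K := (1 + 2 * T * |H.r₀|) with hK
  have hK0 : 0 ≤ K := by positivity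
  set N := K / H.η₀ + 2 * T * e with hN
  have hN0 : 0 ≤ N := by positivity
  refine ⟨N, 1 / (2 * (N + 1)), by positivity, hN0, ?_, ?_⟩
  · rw [div_pow, one_pow, mul_one_div, div_le_one (by positivity)]
    nlinarith
  · intro l hl
    have h1 : K ≤ K / H.η₀ * l := by
      rw [div_mul_eq_mul_div, le_div_iff₀ hη]
      exact mul_le_mul_of_nonneg_left hl hK0
    rw [hN, add_mul]
    linarith

lemma sq_le_sol {d : ℕ} (H : Hypotheses d) {s : ℝ} (hs : 0 ≤ s) {f g₀ : Ed d → ℝ}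
    {u g : ℝ → Ed d → ℝ} (hu : IsBoundedClassicalSolution H.q H.b s f u)
    (hg : IsBoundedClassicalSolution H.q H.b s g₀ g) (hfg : ∀ x, f x ^ 2 ≤ g₀ x)
    {t : ℝ} (ht : s ≤ t) (x : Ed d) : u t x ^ 2 ≤ g t x := by
  rcases ht.eq_or_lt with rfl | ht
  · rw [hu.init, hg.init]; exact hfg x
  obtain ⟨N, β, hβ0, hN0, hβ, hN⟩ := exists_beta H (T := t - s) (by linarith)
  have h := basic_estimate H hs hu hg hfg hβ0 hN hN0 hβ (τ := t - s) ⟨by linarith, le_rfl⟩ x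
  rw [add_sub_cancel] at h
  have : 0 ≤ β ^ 2 * (t - s) * ‖gradient (u t) x‖ ^ 2 := by
    have : 0 ≤ t - s := by linarith
    positivity
  linarith

lemma sol_zero {d : ℕ} {q : ℝ → Ed d → Matrix (Fin d) (Fin d) ℝ} {b : ℝ → Ed d → Ed d}
    {s : ℝ} {g₀ : Ed d → ℝ} {g : ℝ → Ed d → ℝ}
    (hg : IsBoundedClassicalSolution q b s g₀ g) :
    IsBoundedClassicalSolution q b s (fun _ => 0) (fun _ _ => 0) := by
  have := sol_comb hg hg 0 1
  simpa using this

lemma sol_nonneg {d : ℕ} (H : Hypotheses d) {s : ℝ} (hs : 0 ≤ s) {g₀ : Ed d → ℝ}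
    {g : ℝ → Ed d → ℝ} (hg : IsBoundedClassicalSolution H.q H.b s g₀ g) (h0 : ∀ x, 0 ≤ g₀ x)
    {t : ℝ} (ht : s ≤ t) (x : Ed d) : 0 ≤ g t x := by
  have := sq_le_sol H hs (sol_zero hg) hg (fun x => by simpa using h0 x) ht x
  simpa using this

lemma grad_bound {d : ℕ} (H : Hypotheses d) : ∃ β > (0:ℝ), ∀ s : ℝ, 0 ≤ s → ∀ t : ℝ, 0 < t →
    ∀ (f g₀ : Ed d → ℝ) (u g : ℝ → Ed d → ℝ), IsBoundedClassicalSolution H.q H.b s f u →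
    IsBoundedClassicalSolution H.q H.b s g₀ g → (∀ x, f x ^ 2 ≤ g₀ x) → ∀ x,
    β ^ 2 * min t 1 * ‖gradient (u (s + t)) x‖ ^ 2 ≤ g (s + t) x := by
  obtain ⟨N, β, hβ0, hN0, hβ, hN⟩ := exists_beta H (T := 1) (by norm_num)
  refine ⟨β, hβ0, fun s hs t ht f g₀ u g hu hg hfg x => ?_⟩
  rcases le_total t 1 with h | h
  · have := basic_estimate H hs hu hg hfg hβ0 hN hN0 hβ (τ := t) ⟨ht, h⟩ x
    rw [min_eq_left h]
    nlinarith [sq_nonneg (u (s + t) x)]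
  · have hs' : s ≤ s + t - 1 := by linarith
    have := basic_estimate H (hs.trans hs') (sol_restrict hu hs') (sol_restrict hg hs')
      (fun x => sq_le_sol H hs hu hg hfg hs' x) hβ0 hN hN0 hβ (τ := 1) ⟨one_pos, le_rfl⟩ x
    rw [min_eq_right h]
    rw [sub_add_cancel] at this
    nlinarith [sq_nonneg (u (s + t) x)]

lemma tangent {p m r : ℝ} (hp : 1 ≤ p) (hm : 0 < m) (hr : 0 ≤ r) :
    m ^ p + p * m ^ (p - 1) * (r - m) ≤ r ^ p := by
  have h := one_add_mul_self_le_rpow_one_add (s := r / m - 1)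
    (by have : 0 ≤ r / m := by positivity
        linarith) hp
  have h2 := mul_le_mul_of_nonneg_left h (Real.rpow_nonneg hm.le p)
  rw [add_sub_cancel, Real.div_rpow hr hm.le, mul_div_cancel₀ _ (Real.rpow_pos_of_pos hm p).ne'] at h2
  have h3 : m ^ p = m ^ (p - 1) * m := by
    rw [← Real.rpow_add_one hm.ne', sub_add_cancel]
  have h4 : m ^ p * (1 + p * (r / m - 1)) = m ^ p + p * m ^ (p - 1) * (r - m) := by
    rw [h3]; field_simp
  linarith

lemma jensen {d : ℕ} (H : Hypotheses d) {s : ℝ} (hs : 0 ≤ s) {g₀ h₀ : Ed d → ℝ}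
    {g h : ℝ → Ed d → ℝ} (hg : IsBoundedClassicalSolution H.q H.b s g₀ g)
    (hh : IsBoundedClassicalSolution H.q H.b s h₀ h) {p : ℝ} (hp : 1 ≤ p)
    (h0 : ∀ x, 0 ≤ g₀ x) (hgh : ∀ x, g₀ x ^ p = h₀ x) {t : ℝ} (ht : s ≤ t) (x : Ed d) :
    g t x ^ p ≤ h t x := by
  have hm := sol_nonneg H hs hg h0 ht x
  rcases hm.eq_or_lt with hm | hm
  · rw [← hm, Real.zero_rpow (by linarith)]
    exact sol_nonneg H hs hh (fun y => by rw [← hgh]; exact Real.rpow_nonneg (h0 y) p) ht x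
  · set m := g t x with hmd
    have := sol_nonneg H hs (sol_comb hh hg (m ^ p - p * m ^ (p - 1) * m) (p * m ^ (p - 1)))
      (fun y => by
        have := tangent hp hm (h0 y)
        rw [← hgh]
        linarith) ht x
    simp only [← hmd] at this
    linarith

theorem pointwise_gradient_estimate (d : ℕ) (H : Hypotheses d) :
    ∃ C₁ > (0:ℝ), ∀ p : ℝ, 2 ≤ p → ∀ s ∈ Ici (0:ℝ), ∀ t ∈ Ioi (0:ℝ),
      ∀ f : Ed d → ℝ, IsCb f → ∀ x : Ed d,
        ‖gradient (H.G (s + t) s f) x‖ ^ p ≤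
          C₁ ^ p * max (t ^ (-(p/2))) 1 * H.G (s + t) s (fun y => |f y| ^ p) x := by
  obtain ⟨β, hβ, hb⟩ := grad_bound H
  refine ⟨β⁻¹, inv_pos.mpr hβ, fun p hp s hs t ht f hf x => ?_⟩
  have hs0 : 0 ≤ s := hs
  have ht0 : 0 < t := ht
  have hp0 : 0 ≤ p / 2 := by linarith
  obtain ⟨hfc, M, hM⟩ := hf
  have hf2 : IsCb (fun y => f y ^ 2) := ⟨hfc.pow 2, M ^ 2, fun y => by
    rw [abs_pow]; exact pow_le_pow_left₀ (abs_nonneg _) (hM y) 2⟩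
  have hfp : IsCb (fun y => |f y| ^ p) := ⟨hfc.abs.rpow_const (fun _ => Or.inr (by linarith)),
    M ^ p, fun y => by
      rw [abs_of_nonneg (Real.rpow_nonneg (abs_nonneg _) _)]
      exact Real.rpow_le_rpow (abs_nonneg _) (hM y) (by linarith)⟩
  have h1 := hb s hs0 t ht0 f _ _ _ (H.G_sol s hs f ⟨hfc, M, hM⟩) (H.G_sol s hs _ hf2)
    (fun y => le_rfl) x
  have h2 := jensen H hs0 (H.G_sol s hs _ hf2) (H.G_sol s hs _ hfp) (p := p / 2) (by linarith)
    (fun y => sq_nonneg _) (fun y => by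
      rw [← sq_abs, ← Real.rpow_natCast, ← Real.rpow_mul (abs_nonneg _)]
      congr 1; push_cast; ring) (t := s + t) (by linarith) x
  set D := ‖gradient (H.G (s + t) s f) x‖ with hD
  have hD0 : 0 ≤ D := norm_nonneg _
  set W := H.G (s + t) s (fun y => |f y| ^ p) x
  have hmin : 0 < min t 1 := lt_min ht0 one_pos
  have h3 : D ^ 2 * (β ^ 2 * min t 1) ≤ H.G (s + t) s (fun y => f y ^ 2) x := by
    rw [mul_comm]; exact h1
  have h4 := (Real.rpow_le_rpow (by positivity) h3 hp0).trans h2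
  have hsq : ∀ r : ℝ, 0 ≤ r → (r ^ 2) ^ (p / 2) = r ^ p := fun r hr => by
    rw [← Real.rpow_natCast, ← Real.rpow_mul hr]
    congr 1; push_cast; ring
  rw [Real.mul_rpow (by positivity) (by positivity), Real.mul_rpow (by positivity) hmin.le,
    hsq D hD0, hsq β hβ.le] at h4
  have hW : 0 ≤ W := le_trans (by positivity) h4
  have hmp := Real.rpow_pos_of_pos hmin (p / 2)
  have hβp := Real.rpow_pos_of_pos hβ p
  have h5 : (min t 1 ^ (p / 2))⁻¹ ≤ max (t ^ (-(p / 2))) 1 := by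
    rcases le_total t 1 with h | h
    · rw [min_eq_left h, Real.rpow_neg ht0.le]; exact le_max_left _ _
    · rw [min_eq_right h, Real.one_rpow, inv_one]; exact le_max_right _ _
  calc D ^ p ≤ W / (β ^ p * min t 1 ^ (p / 2)) := by
        rw [le_div_iff₀ (by positivity)]; exact h4
    _ = (β⁻¹) ^ p * (min t 1 ^ (p / 2))⁻¹ * W := by
        rw [Real.inv_rpow hβ.le]; field_simp
    _ ≤ _ := by gcongr
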